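/- arXiv:1602.00098 — 4 statements merged into one kernel-verified Lean document; each statement's English description precedes it below -/
import Mathlib

section
/- Let d ≥ 1 and let μ be a finite Borel measure on T^d = [-π,π]^d, symmetric about the origin, with dμ = b dλ + dμ_s (μ_s ⊥ λ, b ≥ 0 in L¹(T^d,λ)). Suppose there exist δ > 0 and ε > 0 such that b(t) ≥ δ for λ-a.e. t ∈ [-ε,ε]^d. Then there is a finite constant γ, depending only on δ, ε, d and μ̂(0), such that for every finite nonempty A ⊆ Z^d the persistence probability satisfies H_X(A) ≥ e^{-γ|A|}. -/
open MeasureTheory ProbabilityTheory Matrix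

noncomputable section

/-- Normalized Lebesgue measure `λ` on `T^d = [-π,π]^d`, with `λ(T^d) = 1`. -/
def normLeb (d : ℕ) : Measure (Fin d → ℝ) :=
  (ENNReal.ofReal ((2 * Real.pi) ^ d))⁻¹ •
    (volume.restrict {t : Fin d → ℝ | ∀ j, |t j| ≤ Real.pi})

/-- Fourier coefficient `μ̂(m) = ∫_{T^d} e^{i⟨m,t⟩} dμ(t)` for `m ∈ ℤ^d`. -/
def muHat {d : ℕ} (μ : Measure (Fin d → ℝ)) (m : Fin d → ℤ) : ℂ :=
  ∫ t, Complex.exp (Complex.I * (∑ j, (m j : ℂ) * (t j : ℂ))) ∂μ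

/-- The matrix `Σ_A = (μ̂(j-k))_{j,k ∈ A}` (real, since `μ` is symmetric). -/
def SigmaA {d : ℕ} (μ : Measure (Fin d → ℝ)) (A : Finset (Fin d → ℤ)) :
    Matrix A A ℝ :=
  fun j k => (muHat μ (j.1 - k.1)).re

/-- `X` is a centered Gaussian vector with covariance matrix `S` (under `P`):
every linear combination of the coordinates is a centered one-dimensional
Gaussian with the corresponding variance. -/
def IsCenteredGaussianVec {ι : Type*} [Fintype ι] {Ω : Type*} [MeasurableSpace Ω]
    (P : Measure Ω) (X : ι → Ω → ℝ) (S : Matrix ι ι ℝ) : Prop :=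
  ∀ u : ι → ℝ,
    P.map (fun ω => ∑ i, u i * X i ω) =
      gaussianReal 0 (Real.toNNReal (u ⬝ᵥ S.mulVec u))


section PersistenceAux
open scoped ENNReal NNReal

lemma gauss_mix (K : ℝ) (hK : 0 < K) :
    (2 * ENNReal.ofReal (Real.exp (-K/2))) • gaussianReal 0 (Real.toNNReal (1/K)) ≤
      gaussianReal (-1) (Real.toNNReal (1/K)) + gaussianReal 1 (Real.toNNReal (1/K)) := by
  have hv : Real.toNNReal (1/K) ≠ 0 := by
    simp only [ne_eq, Real.toNNReal_eq_zero, not_le]; positivity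
  rw [gaussianReal_of_var_ne_zero _ hv, gaussianReal_of_var_ne_zero _ hv,
    gaussianReal_of_var_ne_zero _ hv, ← withDensity_smul _ (measurable_gaussianPDF _ _),
    ← withDensity_add_left (measurable_gaussianPDF _ _)]
  apply withDensity_mono
  refine Filter.Eventually.of_forall fun s => ?_
  simp only [Pi.smul_apply, Pi.add_apply, smul_eq_mul, gaussianPDF]
  have e2 : (2:ℝ≥0∞) = ENNReal.ofReal 2 := by simp
  rw [e2, ← ENNReal.ofReal_mul (by norm_num), ← ENNReal.ofReal_mul (by positivity),
    ← ENNReal.ofReal_add (gaussianPDFReal_nonneg _ _ _) (gaussianPDFReal_nonneg _ _ _)]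
  apply ENNReal.ofReal_le_ofReal
  have hc : ((Real.toNNReal (1/K) : ℝ≥0) : ℝ) = 1/K := Real.coe_toNNReal _ (by positivity)
  simp only [gaussianPDFReal, hc]
  set c := (√(2 * Real.pi * (1 / K)))⁻¹
  have hc0 : 0 ≤ c := by positivity
  have h1 : -(s - -1) ^ 2 / (2 * (1 / K)) = -K/2 + -(s-0)^2/(2 * (1/K)) + -(s * K) := by
    field_simp; ring
  have h2 : -(s - 1) ^ 2 / (2 * (1 / K)) = -K/2 + -(s-0)^2/(2 * (1/K)) + (s * K) := by
    field_simp; ring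
  rw [h1, h2, Real.exp_add _ (-(s*K)), Real.exp_add _ (s*K), Real.exp_add (-K/2)]
  have h3 := Real.one_le_cosh (s*K)
  rw [Real.cosh_eq] at h3
  have h4 : 0 ≤ c * (Real.exp (-K/2) * Real.exp (-(s-0)^2/(2 * (1/K)))) := by positivity
  nlinarith

lemma cameron_martin {ι : Type*} [Fintype ι] [DecidableEq ι] (S : Matrix ι ι ℝ)
    (hsym : S.IsHermitian)
    (ρ : Measure (EuclideanSpace ℝ ι)) [IsProbabilityMeasure ρ]
    (hρ : ∀ t : EuclideanSpace ℝ ι, charFun ρ t = Complex.exp (-((t.ofLp ⬝ᵥ S *ᵥ t.ofLp : ℝ) : ℂ) / 2))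
    (h : EuclideanSpace ℝ ι) (K : ℝ) (hK : 0 < K)
    (hh : ∀ u : ι → ℝ, (u ⬝ᵥ h.ofLp) ^ 2 ≤ K * (u ⬝ᵥ S *ᵥ u))
    (B : Set (EuclideanSpace ℝ ι)) (hB : MeasurableSet B) (hBs : ∀ x, x ∈ B → -x ∈ B) :
    ENNReal.ofReal (Real.exp (-K/2)) * ρ B ≤ ρ ((fun x => x - h) ⁻¹' B) := by
  set S' : Matrix ι ι ℝ := S - (1/K) • Matrix.vecMulVec h.ofLp h.ofLp with hS'
  have hquad : ∀ u : ι → ℝ, u ⬝ᵥ S' *ᵥ u = u ⬝ᵥ S *ᵥ u - (1/K) * (u ⬝ᵥ h.ofLp)^2 := by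
    intro u
    rw [hS', Matrix.sub_mulVec, dotProduct_sub, Matrix.smul_mulVec, dotProduct_smul,
      Matrix.vecMulVec_mulVec, dotProduct_smul]
    simp only [dotProduct_comm h.ofLp u, MulOpposite.smul_eq_mul_unop, MulOpposite.unop_op, smul_eq_mul]
    ring
  have hpsd : S'.PosSemidef := by
    refine Matrix.PosSemidef.of_dotProduct_mulVec_nonneg ?_ ?_
    · refine hsym.sub ?_
      ext i j
      simp [Matrix.vecMulVec_apply, mul_comm]
    · intro u
      have := hh u
      rw [star_trivial, hquad]
      have h3 : (1/K) * (u ⬝ᵥ h.ofLp)^2 ≤ (1/K) * (K * (u ⬝ᵥ S *ᵥ u)) := by gcongr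
      rw [← mul_assoc, one_div_mul_cancel hK.ne', one_mul] at h3
      linarith
  set v := Real.toNNReal (1/K) with hv
  have hvc : (v : ℝ) = 1/K := Real.coe_toNNReal _ (by positivity)
  set ν := multivariateGaussian (0 : EuclideanSpace ℝ ι) S' with hν
  let G : ℝ → Measure (EuclideanSpace ℝ ι) := fun m => (gaussianReal m v).map (fun s => s • h)
  have hGp : ∀ m, IsProbabilityMeasure (G m) := fun m =>
    Measure.isProbabilityMeasure_map (by fun_prop)
  have hG : ∀ m t, charFun (G m) t =
      Complex.exp ((inner ℝ h t : ℝ) * m * Complex.I - (1/K : ℝ) * (inner ℝ h t : ℝ)^2/2) := by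
    intro m t
    have := charFun_gaussianReal (μ := m) (v := v) (inner ℝ h t)
    rw [charFun_apply_real] at this
    rw [charFun_apply, integral_map (by fun_prop) (by fun_prop)]
    have e : ((v : ℝ) : ℂ) = ((1/K : ℝ) : ℂ) := by rw [hvc]
    rw [← e, ← this]
    congr 1
    ext s
    congr 2
    rw [real_inner_smul_left]
    push_cast
    ring
  have hin : ∀ t : EuclideanSpace ℝ ι, t.ofLp ⬝ᵥ h.ofLp = inner ℝ h t := by
    intro t
    simp [PiLp.inner_apply, dotProduct]
  have hR : ∀ m t, charFun (ν ∗ G m) t =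
      Complex.exp ((inner ℝ h t : ℝ) * m * Complex.I - ((t.ofLp ⬝ᵥ S *ᵥ t.ofLp : ℝ) : ℂ) / 2) := by
    intro m t
    rw [charFun_conv, hG, hν, charFun_multivariateGaussian hpsd, ← Complex.exp_add]
    congr 1
    have e : ((t.ofLp ⬝ᵥ S' *ᵥ t.ofLp : ℝ) : ℂ) =
      ((t.ofLp ⬝ᵥ S *ᵥ t.ofLp : ℝ) : ℂ) - (1/K : ℝ) * (inner ℝ h t : ℝ)^2 := by
      rw [hquad, hin]; push_cast; ring
    rw [e]
    simp
    ring
  have hρ0 : ρ = ν ∗ G 0 := by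
    apply Measure.ext_of_charFun
    ext t
    rw [hρ, hR]
    congr 1
    simp
    ring
  have hshift : ρ.map (fun x => x - h) = ν ∗ G (-1) := by
    have : IsProbabilityMeasure (ρ.map (fun x => x - h)) :=
      Measure.isProbabilityMeasure_map (by fun_prop)
    apply Measure.ext_of_charFun
    ext t
    simp_rw [sub_eq_add_neg]
    rw [charFun_map_add_const, hρ, hR, ← Complex.exp_add]
    congr 1
    simp
    ring
  have hneg : (ν ∗ G (-1)).map (fun x => -x) = ν ∗ G 1 := by
    have : IsProbabilityMeasure ((ν ∗ G (-1)).map (fun x => -x)) :=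
      Measure.isProbabilityMeasure_map (by fun_prop)
    apply Measure.ext_of_charFun
    ext t
    have e : (fun x : EuclideanSpace ℝ ι => -x) = (fun x => (-1 : ℝ) • x) := by ext; simp
    rw [e, charFun_map_smul, hR, hR]
    congr 1
    simp [Matrix.mulVec_neg]
  have hBB : (ν ∗ G 1) B = (ν ∗ G (-1)) B := by
    rw [← hneg, Measure.map_apply (by fun_prop) hB]
    congr 1
    ext x
    exact ⟨fun hx => by simpa using hBs _ hx, fun hx => hBs _ hx⟩
  have happ : ∀ m, (ν ∗ G m) B = ∫⁻ z, gaussianReal m v {s | z + s • h ∈ B} ∂ν := by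
    intro m
    rw [Measure.conv, Measure.map_apply (by fun_prop) hB, Measure.prod_apply (by measurability)]
    congr 1
    ext z
    rw [Measure.map_apply (by fun_prop)]
    · rfl
    · exact measurable_prodMk_left ((measurable_add : Measurable fun p : EuclideanSpace ℝ ι × EuclideanSpace ℝ ι => p.1 + p.2) hB)
  rw [← Measure.map_apply (by fun_prop) hB, hshift]
  have hmain : 2 * (ENNReal.ofReal (Real.exp (-K/2)) * ρ B) ≤ 2 * (ν ∗ G (-1)) B := by
    rw [two_mul ((ν ∗ G (-1)) B)]
    nth_rewrite 2 [← hBB]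
    rw [hρ0, happ, happ, happ, ← mul_assoc]
    have hme : ∀ m, Measurable fun z => gaussianReal m v {s | z + s • h ∈ B} := by
      intro m
      have : MeasurableSet ((fun p : EuclideanSpace ℝ ι × ℝ => p.1 + p.2 • h) ⁻¹' B) :=
        (by fun_prop : Measurable (fun p : EuclideanSpace ℝ ι × ℝ => p.1 + p.2 • h)) hB
      exact measurable_measure_prodMk_left this
    rw [← lintegral_const_mul _ (hme 0), ← lintegral_add_left (hme (-1))]
    apply lintegral_mono
    intro z
    have := gauss_mix K hK {s | z + s • h ∈ B}
    rw [← hv] at this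
    simpa using this
  exact (ENNReal.mul_le_mul_iff_right (by norm_num) (by norm_num)).1 hmain

lemma cauchy_schwarz_int {α : Type*} [MeasurableSpace α] (ν : Measure α) (a b : α → ℝ)
    (ha : Integrable (fun x => a x ^ 2) ν) (hb : Integrable (fun x => b x ^ 2) ν)
    (hab : Integrable (fun x => a x * b x) ν) :
    (∫ x, a x * b x ∂ν) ^ 2 ≤ (∫ x, a x ^ 2 ∂ν) * (∫ x, b x ^ 2 ∂ν) := by
  have h := discrim_le_zero (a := ∫ x, a x ^ 2 ∂ν) (b := 2 * ∫ x, a x * b x ∂ν)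
    (c := ∫ x, b x ^ 2 ∂ν) (fun s => by
      have : (∫ x, a x ^ 2 ∂ν) * (s * s) + 2 * (∫ x, a x * b x ∂ν) * s + ∫ x, b x ^ 2 ∂ν
          = ∫ x, (s * a x + b x) ^ 2 ∂ν := by
        have e : ∀ x, (s * a x + b x) ^ 2 = (s * s) * (a x ^ 2) + (2 * s) * (a x * b x) + b x ^ 2 :=
          fun x => by ring
        simp_rw [e]
        rw [integral_add (by fun_prop) hb, integral_add (by fun_prop) (by fun_prop),
          integral_const_mul, integral_const_mul]
        ring
      rw [this]
      positivity)
  rw [discrim] at h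
  nlinarith

def chr {d : ℕ} (m : Fin d → ℤ) (t : Fin d → ℝ) : ℂ :=
  Complex.exp (Complex.I * (∑ j, (m j : ℂ) * (t j : ℂ)))

lemma chr_eq_ofReal {d : ℕ} (m : Fin d → ℤ) (t : Fin d → ℝ) :
    chr m t = Complex.exp ((∑ j, (m j : ℝ) * t j : ℝ) * Complex.I) := by
  rw [chr]; push_cast; rw [mul_comm]

lemma norm_chr {d : ℕ} (m : Fin d → ℤ) (t : Fin d → ℝ) : ‖chr m t‖ = 1 := by
  rw [chr_eq_ofReal, Complex.norm_exp_ofReal_mul_I]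

@[fun_prop]
lemma continuous_chr {d : ℕ} (m : Fin d → ℤ) : Continuous (chr m) := by
  unfold chr; fun_prop

lemma chr_sub {d : ℕ} (m n : Fin d → ℤ) (t : Fin d → ℝ) :
    chr (m - n) t = chr m t * (starRingEnd ℂ) (chr n t) := by
  rw [chr_eq_ofReal n, ← Complex.exp_conj, chr, chr, ← Complex.exp_add]
  congr 1
  simp [sub_mul, Finset.sum_sub_distrib, mul_sub]
  ring

lemma muHat_eq {d : ℕ} (μ : Measure (Fin d → ℝ)) (m : Fin d → ℤ) : muHat μ m = ∫ t, chr m t ∂μ := rfl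

def trig {d : ℕ} {A : Finset (Fin d → ℤ)} (u : A → ℝ) (t : Fin d → ℝ) : ℂ :=
  ∑ j : A, (u j : ℂ) * chr j.1 t

@[fun_prop]
lemma continuous_trig {d : ℕ} {A : Finset (Fin d → ℤ)} (u : A → ℝ) : Continuous (trig u) := by
  unfold trig; fun_prop

lemma norm_trig_le {d : ℕ} {A : Finset (Fin d → ℤ)} (u : A → ℝ) (t : Fin d → ℝ) :
    ‖trig u t‖ ≤ ∑ j, |u j| := by
  refine (norm_sum_le _ _).trans (Finset.sum_le_sum fun j _ => ?_)
  simp [norm_chr]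

lemma integrable_chr {d : ℕ} (ν : Measure (Fin d → ℝ)) [IsFiniteMeasure ν] (m : Fin d → ℤ) :
    Integrable (chr m) ν :=
  Integrable.of_bound (continuous_chr m).aestronglyMeasurable 1
    (Filter.Eventually.of_forall fun t => (norm_chr m t).le)

lemma integrable_trig_mul {d : ℕ} (ν : Measure (Fin d → ℝ)) [IsFiniteMeasure ν]
    {A : Finset (Fin d → ℤ)} (u c : A → ℝ) :
    Integrable (fun t => ‖trig u t‖ * ‖trig c t‖) ν := by
  refine Integrable.of_bound (by fun_prop) ((∑ j, |u j|) * (∑ j, |c j|))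
    (Filter.Eventually.of_forall fun t => ?_)
  rw [norm_mul, norm_norm, norm_norm]
  gcongr
  · exact norm_trig_le u t
  · exact norm_trig_le c t

lemma trig_mul_conj {d : ℕ} {A : Finset (Fin d → ℤ)} (u c : A → ℝ) (t : Fin d → ℝ) :
    trig u t * (starRingEnd ℂ) (trig c t) =
      ∑ j : A, ∑ k : A, ((u j : ℂ) * (c k : ℂ)) * chr (j.1 - k.1) t := by
  rw [trig, trig, map_sum, Finset.sum_mul_sum]
  refine Finset.sum_congr rfl fun j _ => Finset.sum_congr rfl fun k _ => ?_
  rw [chr_sub, map_mul, Complex.conj_ofReal]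
  ring

lemma quad_eq {d : ℕ} (ν : Measure (Fin d → ℝ)) [IsFiniteMeasure ν]
    (A : Finset (Fin d → ℤ)) (u : A → ℝ) :
    u ⬝ᵥ SigmaA ν A *ᵥ u = ∫ t, ‖trig u t‖ ^ 2 ∂ν := by
  have h1 : (∫ t, ((‖trig u t‖ ^ 2 : ℝ) : ℂ) ∂ν) =
      ∑ j : A, ∑ k : A, ((u j : ℂ) * (u k : ℂ)) * muHat ν (j.1 - k.1) := by
    have e : ∀ t, ((‖trig u t‖ ^ 2 : ℝ) : ℂ) =
      ∑ j : A, ∑ k : A, ((u j : ℂ) * (u k : ℂ)) * chr (j.1 - k.1) t := by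
      intro t
      rw [← trig_mul_conj, Complex.mul_conj, Complex.normSq_eq_norm_sq]
    simp_rw [e]
    rw [integral_finsetSum _ fun j _ => integrable_finsetSum _ fun k _ =>
      (integrable_chr ν _).const_mul _]
    refine Finset.sum_congr rfl fun j _ => ?_
    rw [integral_finsetSum _ fun k _ => (integrable_chr ν _).const_mul _]
    refine Finset.sum_congr rfl fun k _ => ?_
    rw [integral_const_mul, muHat_eq]
  rw [integral_complex_ofReal] at h1
  have h2 := congrArg Complex.re h1
  rw [Complex.ofReal_re] at h2
  rw [h2]
  simp only [dotProduct, Matrix.mulVec, SigmaA, Complex.re_sum, Finset.mul_sum]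
  refine Finset.sum_congr rfl fun j _ => Finset.sum_congr rfl fun k _ => ?_
  rw [← Complex.ofReal_mul, Complex.re_ofReal_mul]
  ring

lemma sigma_hermitian {d : ℕ} (ν : Measure (Fin d → ℝ)) (A : Finset (Fin d → ℤ)) :
    (SigmaA ν A).IsHermitian := by
  ext j k
  simp only [Matrix.conjTranspose_apply, SigmaA, star_trivial]
  have : muHat ν (k.1 - j.1) = (starRingEnd ℂ) (muHat ν (j.1 - k.1)) := by
    rw [muHat_eq, muHat_eq, ← integral_conj]
    congr 1
    ext t
    rw [chr_sub, chr_sub]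
    simp [mul_comm]
  rw [this, Complex.conj_re]

instance normLeb_finite (d : ℕ) : IsFiniteMeasure (normLeb d) := by
  have hs : {t : Fin d → ℝ | ∀ j, |t j| ≤ Real.pi} = Set.pi Set.univ (fun _ => Set.Icc (-Real.pi) Real.pi) := by
    ext t; simp only [Set.mem_ofPred_eq, abs_le, Set.mem_pi, Set.mem_univ, true_imp_iff, Set.mem_Icc]
  refine ⟨?_⟩
  rw [normLeb, hs]
  simp only [Measure.smul_apply, Measure.restrict_apply_univ, smul_eq_mul]
  refine ENNReal.mul_lt_top ?_ ?_
  · have : 0 < (2 * Real.pi) ^ d := by positivity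
    simpa [ENNReal.inv_lt_top] using this
  · exact (isCompact_univ_pi fun _ => isCompact_Icc).measure_lt_top

lemma normLeb_integral_prod (d : ℕ) (F : Fin d → ℝ → ℂ) :
    ∫ t, ∏ j, F j (t j) ∂(normLeb d) =
      (((2 * Real.pi) ^ d)⁻¹ : ℝ) * ∏ j, ∫ x in Set.Icc (-Real.pi) Real.pi, F j x := by
  have hs : {t : Fin d → ℝ | ∀ j, |t j| ≤ Real.pi} = Set.pi Set.univ (fun _ => Set.Icc (-Real.pi) Real.pi) := by
    ext t; simp only [Set.mem_ofPred_eq, abs_le, Set.mem_pi, Set.mem_univ, true_imp_iff, Set.mem_Icc]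
  rw [normLeb, hs, integral_smul_measure, volume_pi, Measure.restrict_pi_pi,
    integral_fintype_prod_eq_prod]
  rw [← ENNReal.ofReal_inv_of_pos (by positivity), ENNReal.toReal_ofReal (by positivity)]
  simp

lemma chr_prod {d : ℕ} (m : Fin d → ℤ) (t : Fin d → ℝ) :
    chr m t = ∏ j, Complex.exp (((m j : ℝ) * t j : ℝ) * Complex.I) := by
  rw [chr_eq_ofReal, ← Complex.exp_sum]
  push_cast
  rw [Finset.sum_mul]

lemma int_exp (m : ℤ) : ∫ x in Set.Icc (-Real.pi) Real.pi, Complex.exp (((m : ℝ) * x : ℝ) * Complex.I)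
    = if m = 0 then ((2 * Real.pi : ℝ) : ℂ) else 0 := by
  rw [integral_Icc_eq_integral_Ioc, ← intervalIntegral.integral_of_le (by linarith [Real.pi_pos])]
  split_ifs with hm
  · simp [hm]; ring
  · have hc : (m : ℂ) * Complex.I ≠ 0 := by simp [hm]
    have e : ∀ x : ℝ, Complex.exp (((m : ℝ) * x : ℝ) * Complex.I) = Complex.exp ((m * Complex.I) * x) := by
      intro x; congr 1; push_cast; ring
    simp_rw [e]
    rw [integral_exp_mul_complex hc]
    have : Complex.exp (m * Complex.I * (Real.pi : ℝ)) = Complex.exp (m * Complex.I * (-Real.pi : ℝ)) := by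
      rw [Complex.exp_eq_exp_iff_exists_int]
      exact ⟨m, by push_cast; ring⟩
    rw [this]; simp

lemma muHat_normLeb (d : ℕ) (m : Fin d → ℤ) : muHat (normLeb d) m = if m = 0 then 1 else 0 := by
  rw [muHat_eq]
  simp_rw [chr_prod]
  rw [normLeb_integral_prod d (fun j x => Complex.exp (((m j : ℝ) * x : ℝ) * Complex.I))]
  simp_rw [int_exp]
  split_ifs with h
  · subst h
    simp
  · obtain ⟨j, hj⟩ := Function.ne_iff.1 h
    rw [Finset.prod_eq_zero (Finset.mem_univ j)]
    · simp
    · simpa using hj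

lemma parseval (d : ℕ) (A : Finset (Fin d → ℤ)) (c : A → ℝ) :
    ∫ t, ‖trig c t‖ ^ 2 ∂(normLeb d) = ∑ a, c a ^ 2 := by
  rw [← quad_eq]
  have : SigmaA (normLeb d) A = 1 := by
    ext j k
    rw [SigmaA, muHat_normLeb, Matrix.one_apply]
    by_cases h : j = k
    · simp [h]
    · have : j.1 - k.1 ≠ 0 := by
        rw [sub_ne_zero]; exact fun h' => h (Subtype.ext h')
      simp [h, this]
  rw [this, Matrix.one_mulVec]
  simp [dotProduct, sq]

def tent (η x : ℝ) : ℝ := max 0 (η - |x|)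

lemma tent_nonneg (η x : ℝ) : 0 ≤ tent η x := le_max_left _ _

lemma tent_le {η : ℝ} (hη : 0 < η) (x : ℝ) : tent η x ≤ η :=
  max_le hη.le (by linarith [abs_nonneg x])

lemma tent_eq_zero {η x : ℝ} (h : ¬ |x| ≤ η) : tent η x = 0 :=
  max_eq_left (by linarith)

@[fun_prop]
lemma continuous_tent (η : ℝ) : Continuous (tent η) := by
  unfold tent; fun_prop


def tentHat (η : ℝ) (m : ℤ) : ℝ := 2 * ∫ x in (0:ℝ)..η, (η - x) * Real.cos (m * x)

lemma tentHat_zero (η : ℝ) (hη : 0 < η) : 0 < tentHat η 0 := by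
  have : ∀ x ∈ Set.uIcc 0 η, HasDerivAt (fun x => η * x - x^2/2) ((η - x) * Real.cos ((0:ℤ) * x)) x := by
    intro x _
    have := ((hasDerivAt_id x).const_mul η).sub (((hasDerivAt_id x).pow 2).div_const 2)
    convert! this using 1
    simp
  rw [tentHat, intervalIntegral.integral_eq_sub_of_hasDerivAt this
    (Continuous.intervalIntegrable (by fun_prop) _ _)]
  nlinarith

lemma tentHat_nonneg (η : ℝ) (hη : 0 < η) (m : ℤ) : 0 ≤ tentHat η m := by
  by_cases hm : m = 0
  · subst hm; exact (tentHat_zero η hη).le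
  have hm' : (m : ℝ) ≠ 0 := by exact_mod_cast hm
  have : ∀ x ∈ Set.uIcc 0 η, HasDerivAt
      (fun x => (η - x) * (Real.sin (m * x) / m) - Real.cos (m * x) / m ^ 2)
      ((η - x) * Real.cos (m * x)) x := by
    intro x _
    have h0 : HasDerivAt (fun x : ℝ => (m:ℝ) * x) m x := by
      simpa using (hasDerivAt_id x).const_mul (m:ℝ)
    have := (((hasDerivAt_id x).const_sub η).mul (h0.sin.div_const (m:ℝ))).sub
      (h0.cos.div_const ((m:ℝ)^2))
    convert! this using 1
    simp
    field_simp
    ring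
  rw [tentHat, intervalIntegral.integral_eq_sub_of_hasDerivAt this
    (Continuous.intervalIntegrable (by fun_prop) _ _)]
  simp only [sub_self, zero_mul, mul_zero, Real.sin_zero, Real.cos_zero, zero_div, zero_sub]
  have h1 : Real.cos (m * η) / (m:ℝ)^2 ≤ 1 / (m:ℝ)^2 := by
    gcongr
    exact Real.cos_le_one _
  linarith

lemma tent_integral (η : ℝ) (hη : 0 < η) (hη' : η ≤ Real.pi) (m : ℤ) :
    ∫ x in Set.Icc (-Real.pi) Real.pi,
      ((tent η x : ℝ) : ℂ) * Complex.exp (((m : ℝ) * x : ℝ) * Complex.I) = (tentHat η m : ℝ) := by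
  rw [setIntegral_eq_integral_of_forall_compl_eq_zero]
  swap
  · intro x hx
    rw [tent_eq_zero]
    · simp
    · intro h
      exact hx (abs_le.1 (h.trans hη'))
  have hcs : HasCompactSupport (tent η) := by
    refine HasCompactSupport.intro (K := Set.Icc (-η) η) isCompact_Icc fun x hx => ?_
    exact tent_eq_zero fun h => hx (abs_le.1 h)
  have hint : Integrable (fun x => tent η x * Real.cos (m * x)) :=
    Continuous.integrable_of_hasCompactSupport (by fun_prop) hcs.mul_right
  have hint2 : Integrable (fun x => tent η x * Real.sin (m * x)) :=
    Continuous.integrable_of_hasCompactSupport (by fun_prop) hcs.mul_right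
  have e : ∀ x : ℝ, ((tent η x : ℝ) : ℂ) * Complex.exp (((m : ℝ) * x : ℝ) * Complex.I) =
      ((tent η x * Real.cos (m * x) : ℝ) : ℂ) + ((tent η x * Real.sin (m * x) : ℝ) : ℂ) * Complex.I := by
    intro x
    rw [Complex.exp_mul_I, ← Complex.ofReal_cos, ← Complex.ofReal_sin]
    push_cast
    ring
  simp_rw [e]
  rw [integral_add hint.ofReal (hint2.ofReal.mul_const _), integral_mul_const,
    integral_complex_ofReal, integral_complex_ofReal]
  have hodd : ∫ x, tent η x * Real.sin (m * x) = 0 := by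
    have h := integral_neg_eq_self (fun x => tent η x * Real.sin (m * x)) volume
    have h2 : ∀ x, tent η (-x) * Real.sin (m * (-x)) = -(tent η x * Real.sin (m * x)) := by
      intro x; simp [tent]
    simp_rw [h2] at h
    rw [integral_neg] at h
    linarith
  have heven : ∫ x, tent η x * Real.cos (m * x) = tentHat η m := by
    have h := integral_comp_abs (f := fun x => tent η x * Real.cos (m * x))
    have h2 : ∀ x, tent η |x| * Real.cos (m * |x|) = tent η x * Real.cos (m * x) := by
      intro x
      rcases abs_choice x with hx | hx <;> rw [hx] <;> simp [tent]
    simp_rw [h2] at h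
    rw [h, tentHat, intervalIntegral.integral_of_le hη.le]
    congr 1
    have h3 : ∫ x in Set.Ioc 0 η, (η - x) * Real.cos (m * x) =
        ∫ x in Set.Ioc 0 η, tent η x * Real.cos (m * x) := by
      refine setIntegral_congr_fun measurableSet_Ioc fun x hx => ?_
      simp only [tent]
      rw [abs_of_pos hx.1, max_eq_right (by linarith [hx.2])]
    rw [h3]
    refine setIntegral_eq_of_subset_of_forall_sdiff_eq_zero measurableSet_Ioi
      (fun x hx => hx.1) fun x hx => ?_
    rw [tent_eq_zero, zero_mul]
    intro h'
    exact hx.2 ⟨hx.1, (le_abs_self x).trans h'⟩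
  rw [hodd, heven]
  simp

def gz {d : ℕ} (η : ℝ) (t : Fin d → ℝ) : ℝ := ∏ j, tent η (t j)

@[fun_prop]
lemma continuous_gz {d : ℕ} (η : ℝ) : Continuous (gz (d := d) η) := by
  unfold gz; fun_prop

def gHat {d : ℕ} (η : ℝ) (m : Fin d → ℤ) : ℝ := ((2 * Real.pi) ^ d)⁻¹ * ∏ j, tentHat η (m j)

lemma gHat_nonneg {d : ℕ} {η : ℝ} (hη : 0 < η) (m : Fin d → ℤ) : 0 ≤ gHat η m :=
  mul_nonneg (by positivity) (Finset.prod_nonneg fun j _ => tentHat_nonneg η hη _)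

lemma gHat_zero {d : ℕ} {η : ℝ} (hη : 0 < η) : 0 < gHat η (0 : Fin d → ℤ) :=
  mul_pos (by positivity) (Finset.prod_pos fun j _ => tentHat_zero η hη)

lemma gz_integral {d : ℕ} {η : ℝ} (hη : 0 < η) (hη' : η ≤ Real.pi) (m : Fin d → ℤ) :
    ∫ t, (gz η t : ℂ) * chr m t ∂(normLeb d) = (gHat η m : ℝ) := by
  have e : ∀ t : Fin d → ℝ, (gz η t : ℂ) * chr m t =
      ∏ j, ((tent η (t j) : ℝ) : ℂ) * Complex.exp (((m j : ℝ) * t j : ℝ) * Complex.I) := by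
    intro t
    rw [chr_prod, gz, Finset.prod_mul_distrib]
    push_cast
    rfl
  simp_rw [e]
  rw [normLeb_integral_prod d
    (fun j x => ((tent η x : ℝ) : ℂ) * Complex.exp (((m j : ℝ) * x : ℝ) * Complex.I))]
  simp_rw [tent_integral η hη hη']
  rw [gHat]
  push_cast
  rfl

def cube (d : ℕ) (η : ℝ) : Set (Fin d → ℝ) := {t | ∀ j, |t j| ≤ η}

lemma measurable_cube (d : ℕ) (η : ℝ) : MeasurableSet (cube d η) := by
  have : cube d η = ⋂ j, {t | |t j| ≤ η} := by ext; simp [cube]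
  rw [this]
  exact MeasurableSet.iInter fun j => measurableSet_le (by fun_prop) (by fun_prop)

lemma gz_nonneg {d : ℕ} (η : ℝ) (t : Fin d → ℝ) : 0 ≤ gz η t :=
  Finset.prod_nonneg fun j _ => tent_nonneg _ _

lemma gz_le {d : ℕ} {η : ℝ} (hη : 0 < η) (t : Fin d → ℝ) : gz η t ≤ η ^ d := by
  have : gz η t ≤ ∏ _j : Fin d, η :=
    Finset.prod_le_prod (fun j _ => tent_nonneg _ _) fun j _ => tent_le hη _
  simpa using this

lemma gz_eq_zero {d : ℕ} {η : ℝ} {t : Fin d → ℝ} (h : t ∉ cube d η) : gz η t = 0 := by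
  simp only [cube, Set.mem_ofPred_eq, not_forall] at h
  obtain ⟨j, hj⟩ := h
  exact Finset.prod_eq_zero (Finset.mem_univ j) (tent_eq_zero hj)

lemma shift_bound {d : ℕ} {η δ : ℝ} (hη : 0 < η) (hη' : η ≤ Real.pi) (hδ : 0 < δ)
    (μ : Measure (Fin d → ℝ)) [IsFiniteMeasure μ]
    (hμ : ENNReal.ofReal δ • (normLeb d).restrict (cube d η) ≤ μ)
    (A : Finset (Fin d → ℤ)) (c u : A → ℝ) :
    (u ⬝ᵥ fun j : A => ∑ a : A, c a * gHat η (j.1 - a.1)) ^ 2 ≤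
      ((η ^ d) ^ 2 / δ * ∑ a, c a ^ 2) * (u ⬝ᵥ SigmaA μ A *ᵥ u) := by
  set w := u ⬝ᵥ fun j : A => ∑ a : A, c a * gHat η (j.1 - a.1) with hw
  have hgi : ∀ m : Fin d → ℤ, Integrable (fun t => (gz η t : ℂ) * chr m t) (normLeb d) := by
    intro m
    refine Integrable.of_bound (by fun_prop) (η ^ d) (Filter.Eventually.of_forall fun t => ?_)
    rw [norm_mul, norm_chr, mul_one, Complex.norm_real, Real.norm_of_nonneg (gz_nonneg _ _)]
    exact gz_le hη t
  have h1 : (w : ℂ) = ∫ t, (gz η t : ℂ) * (trig u t * (starRingEnd ℂ) (trig c t)) ∂(normLeb d) := by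
    have e : ∀ t : Fin d → ℝ, (gz η t : ℂ) * (trig u t * (starRingEnd ℂ) (trig c t)) =
      ∑ j : A, ∑ k : A, ((u j : ℂ) * (c k : ℂ)) * ((gz η t : ℂ) * chr (j.1 - k.1) t) := by
      intro t
      rw [trig_mul_conj, Finset.mul_sum]
      refine Finset.sum_congr rfl fun j _ => ?_
      rw [Finset.mul_sum]
      refine Finset.sum_congr rfl fun k _ => ?_
      ring
    simp_rw [e]
    rw [integral_finsetSum _ fun j _ => integrable_finsetSum _ fun k _ => (hgi _).const_mul _]
    rw [hw, dotProduct]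
    push_cast
    refine Finset.sum_congr rfl fun j _ => ?_
    rw [integral_finsetSum _ fun k _ => (hgi _).const_mul _, Finset.mul_sum]
    refine Finset.sum_congr rfl fun k _ => ?_
    rw [integral_const_mul, gz_integral hη hη']
    ring
  set ν := (normLeb d).restrict (cube d η) with hν
  have h2 : |w| ≤ η ^ d * ∫ t, ‖trig u t‖ * ‖trig c t‖ ∂ν := by
    have h3 : ‖(w : ℂ)‖ ≤ ∫ t, ‖(gz η t : ℂ) * (trig u t * (starRingEnd ℂ) (trig c t))‖ ∂(normLeb d) := by
      rw [h1]; exact norm_integral_le_integral_norm _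
    rw [Complex.norm_real, Real.norm_eq_abs] at h3
    refine h3.trans ?_
    rw [hν, ← integral_const_mul, ← integral_indicator (measurable_cube d η)]
    refine integral_mono_of_nonneg (Filter.Eventually.of_forall fun t => norm_nonneg _) ?_
      (Filter.Eventually.of_forall fun t => ?_)
    · exact (((integrable_trig_mul (normLeb d) u c).const_mul _).indicator (measurable_cube d η))
    · dsimp only
      rw [norm_mul, norm_mul, RCLike.norm_conj, Complex.norm_real,
        Real.norm_of_nonneg (gz_nonneg _ _)]
      by_cases ht : t ∈ cube d η
      · rw [Set.indicator_of_mem ht]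
        gcongr
        exact gz_le hη t
      · rw [Set.indicator_of_notMem ht, gz_eq_zero ht, zero_mul]
  have hsq : ∀ (ξ : Measure (Fin d → ℝ)) [IsFiniteMeasure ξ] (b : A → ℝ),
      Integrable (fun t => ‖trig b t‖ ^ 2) ξ := by
    intro ξ _ b
    simp_rw [sq]
    exact integrable_trig_mul ξ b b
  have h4 := cauchy_schwarz_int ν (fun t => ‖trig u t‖) (fun t => ‖trig c t‖)
    (hsq ν u) (hsq ν c) (integrable_trig_mul ν u c)
  have h5 : ∫ t, ‖trig c t‖ ^ 2 ∂ν ≤ ∑ a, c a ^ 2 := by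
    rw [← parseval]
    exact integral_mono_measure Measure.restrict_le_self
      (Filter.Eventually.of_forall fun t => by positivity) (hsq _ c)
  have h6 : δ * ∫ t, ‖trig u t‖ ^ 2 ∂ν ≤ u ⬝ᵥ SigmaA μ A *ᵥ u := by
    rw [quad_eq]
    have := integral_mono_measure hμ
      (Filter.Eventually.of_forall fun t => by positivity) (hsq μ u)
    rwa [integral_smul_measure, ENNReal.toReal_ofReal hδ.le, smul_eq_mul] at this
  have h7 : ∫ t, ‖trig u t‖ ^ 2 ∂ν ≤ (u ⬝ᵥ SigmaA μ A *ᵥ u) / δ := by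
    rw [le_div_iff₀ hδ]; linarith
  have h8 : 0 ≤ ∫ t, ‖trig u t‖ ^ 2 ∂ν := by positivity
  have h10 : 0 ≤ (u ⬝ᵥ SigmaA μ A *ᵥ u) / δ := h8.trans h7
  have h9 : 0 ≤ ∫ t, ‖trig u t‖ * ‖trig c t‖ ∂ν := by positivity
  calc w ^ 2 = |w| ^ 2 := (sq_abs w).symm
    _ ≤ (η ^ d * ∫ t, ‖trig u t‖ * ‖trig c t‖ ∂ν) ^ 2 := by gcongr
    _ = (η ^ d) ^ 2 * (∫ t, ‖trig u t‖ * ‖trig c t‖ ∂ν) ^ 2 := by ring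
    _ ≤ (η ^ d) ^ 2 * ((∫ t, ‖trig u t‖ ^ 2 ∂ν) * ∫ t, ‖trig c t‖ ^ 2 ∂ν) := by gcongr
    _ ≤ (η ^ d) ^ 2 * ((u ⬝ᵥ SigmaA μ A *ᵥ u) / δ * ∑ a, c a ^ 2) := by gcongr
    _ = _ := by ring

lemma gvec_aemeas {ι : Type*} [Fintype ι] {Ω : Type*} [MeasurableSpace Ω]
    {P : Measure Ω} {X : ι → Ω → ℝ} {S : Matrix ι ι ℝ} (hX : IsCenteredGaussianVec P X S) (u : ι → ℝ) :
    AEMeasurable (fun ω => ∑ i, u i * X i ω) P := by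
  by_contra h
  have h1 := hX u
  rw [Measure.map_of_not_aemeasurable h] at h1
  have h2 : gaussianReal 0 (Real.toNNReal (u ⬝ᵥ S.mulVec u)) Set.univ = 1 := measure_univ
  rw [← h1] at h2
  simp at h2

lemma gvec_single {ι : Type*} [Fintype ι] [DecidableEq ι] {Ω : Type*}
    (X : ι → Ω → ℝ) (i : ι) :
    (fun ω => ∑ j, (Pi.single i 1 : ι → ℝ) j * X j ω) = X i := by
  ext ω
  simp [Pi.single_apply]

lemma gvec_charFun {ι : Type*} [Fintype ι] {Ω : Type*} [MeasurableSpace Ω]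
    {P : Measure Ω} {X : ι → Ω → ℝ} {S : Matrix ι ι ℝ} (hX : IsCenteredGaussianVec P X S)
    (hm : ∀ i, AEMeasurable (X i) P) (hS : ∀ u : ι → ℝ, 0 ≤ u ⬝ᵥ S *ᵥ u) (t : EuclideanSpace ℝ ι) :
    charFun (P.map (fun ω => WithLp.toLp 2 (fun i => X i ω))) t =
      Complex.exp (-((t.ofLp ⬝ᵥ S *ᵥ t.ofLp : ℝ) : ℂ) / 2) := by
  have hm' : AEMeasurable (fun ω => (WithLp.toLp 2 (fun i => X i ω) : EuclideanSpace ℝ ι)) P :=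
    (WithLp.measurable_toLp 2 (ι → ℝ)).comp_aemeasurable (aemeasurable_pi_lambda _ hm)
  rw [charFun_apply, integral_map hm' (by fun_prop)]
  have h := charFun_gaussianReal (μ := 0) (v := Real.toNNReal (t.ofLp ⬝ᵥ S *ᵥ t.ofLp)) 1
  rw [← hX t.ofLp, charFun_apply_real, integral_map (gvec_aemeas hX _) (by fun_prop),
    Real.coe_toNNReal _ (hS _)] at h
  convert! h using 1
  · congr 1
    ext ω
    congr 1
    simp [PiLp.inner_apply]
  · congr 1
    simp
    ring

lemma gvec_shift {ι : Type*} [Fintype ι] [DecidableEq ι] {Ω : Type*} [MeasurableSpace Ω]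
    {P : Measure Ω} [IsProbabilityMeasure P] {X : ι → Ω → ℝ} {S : Matrix ι ι ℝ}
    (hX : IsCenteredGaussianVec P X S) (hsym : S.IsHermitian)
    (h : ι → ℝ) (K : ℝ) (hK : 0 < K)
    (hh : ∀ u : ι → ℝ, (u ⬝ᵥ h) ^ 2 ≤ K * (u ⬝ᵥ S *ᵥ u)) (c : ι → ℝ) (hc : ∀ i, c i ≤ h i) :
    ENNReal.ofReal (Real.exp (-K/2)) * P {ω | ∀ i, |X i ω| < c i} ≤ P {ω | ∀ i, 0 < X i ω} := by
  have hS : ∀ u : ι → ℝ, 0 ≤ u ⬝ᵥ S *ᵥ u := fun u =>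
    nonneg_of_mul_nonneg_right ((sq_nonneg _).trans (hh u)) hK
  have hm : ∀ i, AEMeasurable (X i) P := fun i => by
    rw [← gvec_single X i]; exact gvec_aemeas hX _
  have hm' : AEMeasurable (fun ω => (WithLp.toLp 2 (fun i => X i ω) : EuclideanSpace ℝ ι)) P :=
    (WithLp.measurable_toLp 2 (ι → ℝ)).comp_aemeasurable (aemeasurable_pi_lambda _ hm)
  set ρ := P.map (fun ω => (WithLp.toLp 2 (fun i => X i ω) : EuclideanSpace ℝ ι)) with hρ
  have : IsProbabilityMeasure ρ := Measure.isProbabilityMeasure_map hm'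
  let B : Set (EuclideanSpace ℝ ι) := {x | ∀ i, |x i| < c i}
  have hB : MeasurableSet B := by
    have : B = ⋂ i, {x : EuclideanSpace ℝ ι | |x i| < c i} := by ext; simp [B]
    rw [this]
    exact MeasurableSet.iInter fun j => measurableSet_lt (by fun_prop) (by fun_prop)
  have hcm := cameron_martin S hsym ρ (gvec_charFun hX hm hS) (WithLp.toLp 2 h) K hK hh B hB
    (fun x hx i => by simpa using hx i)
  rw [hρ, Measure.map_apply_of_aemeasurable hm' hB,
    Measure.map_apply_of_aemeasurable hm' (by exact (by fun_prop : Measurable fun x : EuclideanSpace ℝ ι => x - WithLp.toLp 2 h) hB)] at hcm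
  refine hcm.trans (measure_mono fun ω hω i => ?_)
  have h1 : |X i ω - h i| < c i := hω i
  have := (abs_lt.1 h1).1
  linarith [hc i]

lemma gvec_second {ι : Type*} [Fintype ι] [DecidableEq ι] {Ω : Type*} [MeasurableSpace Ω]
    {P : Measure Ω} {X : ι → Ω → ℝ} {S : Matrix ι ι ℝ}
    (hX : IsCenteredGaussianVec P X S) (i : ι) (hi : 0 ≤ S i i) :
    Integrable (fun ω => X i ω ^ 2) P ∧ ∫ ω, X i ω ^ 2 ∂P = S i i := by
  have hmap : P.map (X i) = gaussianReal 0 (Real.toNNReal (S i i)) := by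
    have := hX (Pi.single i 1)
    rw [gvec_single] at this
    rw [this]
    simp
  have hm : AEMeasurable (X i) P := by
    rw [← gvec_single X i]; exact gvec_aemeas hX _
  have hL : Integrable (fun x : ℝ => x ^ 2) (P.map (X i)) := by
    rw [hmap]
    exact (memLp_id_gaussianReal 2).integrable_sq
  have hv : ∫ x, x ^ 2 ∂(P.map (X i)) = S i i := by
    rw [hmap]
    have := variance_id_gaussianReal (μ := 0) (v := Real.toNNReal (S i i))
    rw [variance_eq_integral (by fun_prop)] at this
    simpa [hi] using this
  constructor
  · exact hL.comp_aemeasurable hm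
  · rw [← hv, integral_map hm (by fun_prop)]

lemma core {ι : Type*} [Fintype ι] [DecidableEq ι] [Nonempty ι] {Ω : Type*} [MeasurableSpace Ω]
    {P : Measure Ω} [IsProbabilityMeasure P] {X : ι → Ω → ℝ} (M : ℝ) (hM : 0 ≤ M)
    (hi : ∀ i, Integrable (fun ω => X i ω ^ 2) P) (hs : ∀ i, ∫ ω, X i ω ^ 2 ∂P = M)
    (C p : ℝ) (hC : 0 ≤ C)
    (hp : ∀ c : ι → ℕ, (∀ i, 1 ≤ c i) →
      Real.exp (-(C * ∑ i, (c i : ℝ) ^ 2) / 2) * P.real {ω | ∀ i, |X i ω| < c i} ≤ p) :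
    Real.exp (-(C * (4 * M + 6) / 2 + (4 * M + 6) + 2) * Fintype.card ι) ≤ p := by
  set n : ℝ := (Fintype.card ι : ℝ) with hn
  have hn1 : 1 ≤ n := by
    rw [hn]; exact_mod_cast Fintype.card_pos
  set B : ℝ := 4 * M + 6 with hB
  have hB0 : 0 ≤ B := by positivity
  -- Markov
  set E : Set Ω := {ω | ∑ i, X i ω ^ 2 < 2 * (M + 1) * n} with hE
  have hmk : 1/2 ≤ P.real E := by
    have h1 := mul_meas_ge_le_integral_of_nonneg (μ := P) (f := fun ω => ∑ i, X i ω ^ 2)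
      (Filter.Eventually.of_forall fun ω => Finset.sum_nonneg fun i _ => sq_nonneg _)
      (integrable_finsetSum _ fun i _ => hi i) (2 * (M + 1) * n)
    rw [integral_finsetSum _ fun i _ => hi i] at h1
    simp only [hs, Finset.sum_const, Finset.card_univ, nsmul_eq_mul, ← hn] at h1
    have h2 : P.real Set.univ ≤ P.real E + P.real {ω | 2 * (M + 1) * n ≤ ∑ i, X i ω ^ 2} := by
      refine le_trans (measureReal_mono ?_) (measureReal_union_le _ _)
      intro ω _
      rcases lt_or_ge (∑ i, X i ω ^ 2) (2 * (M + 1) * n) with h | h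
      · exact Or.inl h
      · exact Or.inr h
    rw [probReal_univ] at h2
    set q := P.real {ω | 2 * (M + 1) * n ≤ ∑ i, X i ω ^ 2}
    have h3 : q ≤ 1/2 := by
      by_contra hq
      push Not at hq
      have : 2 * (M + 1) * n * (1/2) < 2 * (M + 1) * n * q := by gcongr
      nlinarith
    linarith
  -- cover
  set N : ℕ := ⌊n * B⌋₊ with hN
  let T : Finset (ι → ℕ) := (Fintype.piFinset fun _ => Finset.range (N + 1)).filter
    fun c => (∑ i, (c i : ℝ) ^ 2 ≤ n * B) ∧ ∀ i, 1 ≤ c i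
  have hcover : E ⊆ ⋃ c ∈ T, {ω | ∀ i, |X i ω| < c i} := by
    intro ω hω
    have hω' : ∑ i, X i ω ^ 2 < 2 * (M + 1) * n := hω
    let c : ι → ℕ := fun i => ⌊|X i ω|⌋₊ + 1
    have hc1 : ∑ i, (c i : ℝ) ^ 2 ≤ n * B := by
      have : ∑ i, (c i : ℝ) ^ 2 ≤ ∑ i, (2 * X i ω ^ 2 + 2) := by
        refine Finset.sum_le_sum fun i _ => ?_
        have h1 : (⌊|X i ω|⌋₊ : ℝ) ≤ |X i ω| := Nat.floor_le (abs_nonneg _)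
        have h2 : (c i : ℝ) = ⌊|X i ω|⌋₊ + 1 := by simp [c]
        have h3 : (c i : ℝ) ^ 2 ≤ (|X i ω| + 1) ^ 2 := by rw [h2]; gcongr
        nlinarith [sq_abs (X i ω), sq_nonneg (|X i ω| - 1)]
      rw [Finset.sum_add_distrib, ← Finset.mul_sum] at this
      simp only [Finset.sum_const, Finset.card_univ, nsmul_eq_mul, ← hn] at this
      rw [hB]
      nlinarith
    have hcT : c ∈ T := by
      simp only [T, Finset.mem_filter, Fintype.mem_piFinset, Finset.mem_range]
      refine ⟨fun i => ?_, hc1, fun i => by simp [c]⟩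
      rw [Nat.lt_succ_iff, hN]
      apply Nat.le_floor
      have h1 : (c i : ℝ) ^ 2 ≤ ∑ i, (c i : ℝ) ^ 2 :=
        Finset.single_le_sum (f := fun i => (c i : ℝ) ^ 2) (fun i _ => sq_nonneg _) (Finset.mem_univ i)
      have h2 : (1 : ℝ) ≤ c i := by simp [c]
      nlinarith
    simp only [Set.mem_iUnion]
    refine ⟨c, hcT, fun i => ?_⟩
    simpa [c] using Nat.lt_floor_add_one |X i ω|
  have hsum : P.real E ≤ ∑ c ∈ T, P.real {ω | ∀ i, |X i ω| < c i} :=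
    (measureReal_mono hcover (measure_ne_top _ _)).trans (measureReal_biUnion_finset_le _ _)
  have hp0 : 0 ≤ p := le_trans (by positivity) (hp (fun _ => 1) fun _ => le_rfl)
  have hterm : ∀ c ∈ T, P.real {ω | ∀ i, |X i ω| < c i} ≤
      Real.exp (C * (n * B) / 2) * p := by
    intro c hc
    simp only [T, Finset.mem_filter] at hc
    have h1 := hp c hc.2.2
    have h2 : P.real {ω | ∀ i, |X i ω| < c i} ≤ Real.exp ((C * ∑ i, (c i : ℝ) ^ 2) / 2) * p := by
      have := mul_le_mul_of_nonneg_left h1 (Real.exp_nonneg ((C * ∑ i, (c i : ℝ) ^ 2) / 2))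
      rwa [← mul_assoc, ← Real.exp_add, neg_div, add_neg_cancel, Real.exp_zero, one_mul] at this
    refine h2.trans ?_
    gcongr
    exact hc.2.1
  have hcard : (T.card : ℝ) ≤ Real.exp (n * B) * Real.exp n := by
    have h1 : ∀ c ∈ T, (1 : ℝ) ≤ Real.exp (n * B) * ∏ i, Real.exp (-(c i : ℝ)) := by
      intro c hc
      simp only [T, Finset.mem_filter] at hc
      rw [← Real.exp_sum, ← Real.exp_add]
      apply Real.one_le_exp
      rw [Finset.sum_neg_distrib]
      have : ∑ i, (c i : ℝ) ≤ ∑ i, (c i : ℝ) ^ 2 := by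
        refine Finset.sum_le_sum fun i _ => ?_
        have : (1 : ℝ) ≤ c i := by exact_mod_cast hc.2.2 i
        nlinarith
      linarith [hc.2.1]
    have hgeo : ∑ k ∈ Finset.range (N + 1), Real.exp (-(k : ℝ)) ≤ Real.exp 1 := by
      have e : ∀ k : ℕ, Real.exp (-(k : ℝ)) = (Real.exp (-1)) ^ k := by
        intro k; rw [← Real.exp_nat_mul]; congr 1; ring
      simp_rw [e]
      have he : Real.exp (-1) ≤ 1/2 := by
        rw [Real.exp_neg, ← one_div]
        have := Real.add_one_le_exp (1:ℝ)
        gcongr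
        linarith
      have hg : ∑ k ∈ Finset.range (N + 1), (Real.exp (-1)) ^ k ≤
          ∑ k ∈ Finset.range (N + 1), (1/2 : ℝ) ^ k := by gcongr
      have h2 := sum_geometric_two_le (N + 1)
      have := Real.add_one_le_exp (1:ℝ)
      linarith
    calc (T.card : ℝ) = ∑ c ∈ T, (1 : ℝ) := by simp
      _ ≤ ∑ c ∈ T, Real.exp (n * B) * ∏ i, Real.exp (-(c i : ℝ)) := Finset.sum_le_sum h1
      _ ≤ ∑ c ∈ Fintype.piFinset (fun _ : ι => Finset.range (N + 1)),
          Real.exp (n * B) * ∏ i, Real.exp (-(c i : ℝ)) :=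
        Finset.sum_le_sum_of_subset_of_nonneg (Finset.filter_subset _ _)
          fun _ _ _ => by positivity
      _ = Real.exp (n * B) * ∏ _i : ι, ∑ k ∈ Finset.range (N + 1), Real.exp (-(k : ℝ)) := by
        rw [Finset.prod_univ_sum, Finset.mul_sum]
      _ ≤ Real.exp (n * B) * ∏ _i : ι, Real.exp 1 := by
        gcongr
      _ = Real.exp (n * B) * Real.exp n := by
        rw [Finset.prod_const, Finset.card_univ, ← Real.exp_nat_mul, mul_one]
  have hfin : 1/2 ≤ Real.exp (n * B) * Real.exp n * (Real.exp (C * (n * B) / 2) * p) := by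
    calc 1/2 ≤ P.real E := hmk
      _ ≤ _ := hsum
      _ ≤ ∑ c ∈ T, Real.exp (C * (n * B) / 2) * p := Finset.sum_le_sum hterm
      _ = T.card * (Real.exp (C * (n * B) / 2) * p) := by simp
      _ ≤ _ := by gcongr
  have hhalf : Real.exp (-n) ≤ 1/2 := by
    rw [Real.exp_neg, ← one_div]
    have := Real.add_one_le_exp n
    gcongr
    linarith
  have e1 : Real.exp (-(C * B / 2 + B + 2) * n) =
      Real.exp (-n) * Real.exp (-(n * B + n + C * (n * B) / 2)) := by
    rw [← Real.exp_add]; congr 1; ring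
  have e2 : Real.exp (n * B) * Real.exp n * (Real.exp (C * (n * B) / 2) * p) =
      Real.exp (n * B + n + C * (n * B) / 2) * p := by
    rw [Real.exp_add, Real.exp_add]; ring
  rw [e1]
  rw [e2] at hfin
  calc _ ≤ (Real.exp (n * B + n + C * (n * B) / 2) * p) * Real.exp (-(n * B + n + C * (n * B) / 2)) := by
        gcongr; exact hhalf.trans hfin
    _ = p := by
        rw [mul_comm, ← mul_assoc, ← Real.exp_add, neg_add_cancel, Real.exp_zero, one_mul]

lemma lower_measure {d : ℕ} {η ε δ : ℝ} (hηε : η ≤ ε) (μ μs : Measure (Fin d → ℝ))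
    (b : (Fin d → ℝ) → ℝ)
    (hdec : μ = (normLeb d).withDensity (fun t => ENNReal.ofReal (b t)) + μs)
    (hb : ∀ᵐ t ∂(normLeb d), (∀ j, |t j| ≤ ε) → δ ≤ b t) :
    ENNReal.ofReal δ • (normLeb d).restrict (cube d η) ≤ μ := by
  have h1 : ENNReal.ofReal δ • (normLeb d).restrict (cube d η) =
      (normLeb d).withDensity ((cube d η).indicator fun _ => ENNReal.ofReal δ) := by
    rw [withDensity_indicator (measurable_cube d η), withDensity_const]
  rw [h1, hdec]
  refine le_trans (withDensity_mono ?_) (Measure.le_add_right le_rfl)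
  filter_upwards [hb] with t ht
  by_cases h : t ∈ cube d η
  · rw [Set.indicator_of_mem h]
    exact ENNReal.ofReal_le_ofReal (ht fun j => (h j).trans hηε)
  · rw [Set.indicator_of_notMem h]
    exact zero_le

end PersistenceAux

/-- If the absolutely continuous part of the spectral measure has
density bounded below by `δ > 0` a.e. on `[-ε,ε]^d`, then there is a constant `γ`,
depending only on `δ`, `ε`, `d` and `μ̂(0)`, such that for every finite nonempty
`A ⊆ ℤ^d` the persistence probability satisfies `H_X(A) ≥ e^{-γ|A|}`. -/
theorem persistence_exponential_lower_bound
    (d : ℕ) (hd : 1 ≤ d) (δ ε M : ℝ) (hδ : 0 < δ) (hε : 0 < ε) :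
    ∃ γ : ℝ,
      ∀ (μ μs : Measure (Fin d → ℝ)) (b : (Fin d → ℝ) → ℝ),
        IsFiniteMeasure μ →
        μ {t : Fin d → ℝ | ¬ ∀ j, |t j| ≤ Real.pi} = 0 →
        μ.map (fun t => -t) = μ →
        Integrable b (normLeb d) →
        (∀ᵐ t ∂(normLeb d), 0 ≤ b t) →
        μs.MutuallySingular (normLeb d) →
        μ = (normLeb d).withDensity (fun t => ENNReal.ofReal (b t)) + μs →
        (∀ᵐ t ∂(normLeb d), (∀ j, |t j| ≤ ε) → δ ≤ b t) →
        (muHat μ 0).re = M →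
        ∀ (A : Finset (Fin d → ℤ)), A.Nonempty →
          ∀ (Ω : Type) [MeasurableSpace Ω] (P : Measure Ω),
            IsProbabilityMeasure P →
            ∀ X : A → Ω → ℝ,
              IsCenteredGaussianVec P X (SigmaA μ A) →
              ENNReal.ofReal (Real.exp (-γ * (A.card : ℝ))) ≤
                P {ω | ∀ m : A, 0 < X m ω} := by
  set η := min ε Real.pi with hηdef
  have hη : 0 < η := lt_min hε Real.pi_pos
  have hη' : η ≤ Real.pi := min_le_right _ _
  set g := gHat η (0 : Fin d → ℤ) with hg
  have hg0 : 0 < g := gHat_zero hη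
  set C : ℝ := (η ^ d) ^ 2 / δ / g ^ 2 with hC
  have hC0 : 0 < C := by positivity
  refine ⟨C * (4 * M + 6) / 2 + (4 * M + 6) + 2, ?_⟩
  intro μ μs b hfin _ _ _ _ _ hdec hb hM A hA Ω _ P hP X hX
  have hlow := lower_measure (min_le_left ε Real.pi) μ μs b hdec hb
  have : Nonempty A := hA.to_subtype
  have hdiag : ∀ a : A, SigmaA μ A a a = M := by
    intro a
    rw [SigmaA, sub_self, hM]
  have hM0 : 0 ≤ M := by
    rw [← hM, muHat]
    simp
  have hsec := fun a : A => gvec_second hX a (by rw [hdiag]; exact hM0)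
  have hcore := core M hM0 (fun a => (hsec a).1) (fun a => by rw [(hsec a).2, hdiag]) C
    (P.real {ω | ∀ m : A, 0 < X m ω}) hC0.le ?_
  · rw [Fintype.card_coe] at hcore
    rw [← ofReal_measureReal]
    exact ENNReal.ofReal_le_ofReal hcore
  · intro c hc
    have hcs : 0 < ∑ a, (c a : ℝ) ^ 2 := by
      refine Finset.sum_pos (fun a _ => ?_) Finset.univ_nonempty
      have : (1 : ℝ) ≤ c a := by exact_mod_cast hc a
      positivity
    have key := gvec_shift hX (sigma_hermitian μ A)
      (fun j : A => ∑ a : A, ((c a : ℝ) / g) * gHat η (j.1 - a.1)) (C * ∑ a, (c a : ℝ) ^ 2)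
      (by positivity) ?_ (fun a => (c a : ℝ)) ?_
    · have h2 := ENNReal.toReal_mono (measure_ne_top _ _) key
      rw [ENNReal.toReal_mul, ENNReal.toReal_ofReal (Real.exp_nonneg _)] at h2
      exact h2
    · intro u
      have h3 := shift_bound hη hη' hδ μ hlow A (fun a => (c a : ℝ) / g) u
      refine h3.trans_eq ?_
      congr 1
      simp_rw [div_pow]
      rw [← Finset.sum_div, hC]
      ring
    · intro j
      have h4 : (c j : ℝ) = ((c j : ℝ) / g) * gHat η (j.1 - j.1) := by
        rw [sub_self, ← hg]; field_simp
      rw [h4]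
      exact Finset.single_le_sum (f := fun a : A => ((c a : ℝ) / g) * gHat η (j.1 - a.1))
        (fun a _ => mul_nonneg (by positivity) (gHat_nonneg hη _)) (Finset.mem_univ j)
end
end

section
/- Let d = 1 and let μ be a finite Borel measure on T = [-π,π], symmetric about the origin, with dμ = b dλ + dμ_s (μ_s ⊥ λ, b ≥ 0 in L¹(T,λ)). If b is not λ-a.e. equal to zero, then there is a finite constant γ (depending on μ) such that H_X(N) ≥ e^{-γ N²} for all N ≥ 1. -/
open MeasureTheory ProbabilityTheory Matrix

noncomputable section

/-- Normalized Lebesgue measure `λ` on `T = [-π,π]`, with `λ(T) = 1`. -/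
def normLeb1 : Measure ℝ :=
  (ENNReal.ofReal (2 * Real.pi))⁻¹ • (volume.restrict (Set.Icc (-Real.pi) Real.pi))

/-- Fourier coefficient `μ̂(m) = ∫_T e^{imt} dμ(t)` for `m ∈ ℤ`. -/
def muHat1 (μ : Measure ℝ) (m : ℤ) : ℂ :=
  ∫ t, Complex.exp (Complex.I * (m : ℂ) * (t : ℂ)) ∂μ

/-- The matrix `Σ_N = (μ̂(j-k))_{1 ≤ j,k ≤ N}` (real, since `μ` is symmetric). -/
def SigmaN (μ : Measure ℝ) (N : ℕ) : Matrix (Fin N) (Fin N) ℝ :=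
  fun j k => (muHat1 μ ((j.1 : ℤ) - (k.1 : ℤ))).re

lemma aux_gauss_one (s : Set ℝ) :
    ENNReal.ofReal (1 / 6) * volume (s ∩ Set.Icc (-1) 1) ≤ gaussianReal 0 1 s := by
  calc ENNReal.ofReal (1 / 6) * volume (s ∩ Set.Icc (-1) 1)
      = ∫⁻ x in s ∩ Set.Icc (-1) 1, ENNReal.ofReal (1 / 6) := by
        rw [setLIntegral_const]
    _ ≤ ∫⁻ x in s ∩ Set.Icc (-1) 1, gaussianPDF 0 1 x := by
        refine lintegral_mono_ae ?_
        have h1 : ∀ᵐ x ∂(volume.restrict (s ∩ Set.Icc (-1:ℝ) 1)), x ∈ Set.Icc (-1:ℝ) 1 := by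
          refine ae_mono (Measure.restrict_mono Set.inter_subset_right le_rfl) ?_
          exact ae_restrict_mem measurableSet_Icc
        filter_upwards [h1] with x hx
        rw [gaussianPDF]
        apply ENNReal.ofReal_le_ofReal
        rw [gaussianPDFReal]
        have hx2 : x ^ 2 ≤ 1 := by
          have := hx.1; have := hx.2; nlinarith
        have e1 : (1:ℝ) / 2 ≤ Real.exp (-(x - 0) ^ 2 / (2 * ((1 : NNReal) : ℝ))) := by
          have := Real.add_one_le_exp (-(x - 0) ^ 2 / (2 * ((1 : NNReal) : ℝ)))
          refine le_trans ?_ this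
          simp only [NNReal.coe_one]
          linarith
        have e2 : (1:ℝ) / 3 ≤ (√(2 * Real.pi * ((1 : NNReal) : ℝ)))⁻¹ := by
          rw [one_div]
          apply inv_anti₀ (by simp [Real.pi_pos])
          rw [Real.sqrt_le_left (by norm_num)]
          have := Real.pi_lt_four
          simp only [NNReal.coe_one]
          linarith
        calc (1:ℝ) / 6 = 1 / 3 * (1 / 2) := by norm_num
          _ ≤ _ := mul_le_mul e2 e1 (by norm_num) (by positivity)
    _ ≤ ∫⁻ x in s, gaussianPDF 0 1 x := lintegral_mono_set Set.inter_subset_left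
    _ = gaussianReal 0 1 s := by rw [gaussianReal_apply 0 one_ne_zero]

lemma aux_gauss_pi (N : ℕ) (s : Set (Fin N → ℝ)) (hs : MeasurableSet s)
    (hsub : s ⊆ Set.univ.pi fun _ => Set.Icc (-1:ℝ) 1) :
    ENNReal.ofReal (1 / 6) ^ N * volume s ≤ Measure.pi (fun _ : Fin N => gaussianReal 0 1) s := by
  set n : OuterMeasure (Fin N → ℝ) :=
    (ENNReal.ofReal (1 / 6) ^ N • (volume.restrict
      (Set.univ.pi fun _ : Fin N => Set.Icc (-1:ℝ) 1))).toOuterMeasure with hn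
  have key : n ≤ OuterMeasure.pi
      (fun _ : Fin N => (gaussianReal 0 1).toOuterMeasure) := by
    rw [OuterMeasure.le_pi]
    intro t _
    have hm : MeasurableSet (Set.univ.pi fun _ : Fin N => Set.Icc (-1:ℝ) 1) :=
      MeasurableSet.univ_pi fun _ => measurableSet_Icc
    have : n (Set.univ.pi t) = ENNReal.ofReal (1 / 6) ^ N *
        volume (Set.univ.pi t ∩ Set.univ.pi fun _ : Fin N => Set.Icc (-1:ℝ) 1) := by
      simp only [hn, Measure.toOuterMeasure_apply, Measure.smul_apply, smul_eq_mul]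
      rw [Measure.restrict_apply' hm]
    rw [this, ← Set.pi_inter_distrib, volume_pi_pi]
    have : ENNReal.ofReal (1 / 6) ^ N = ∏ _i : Fin N, ENNReal.ofReal (1 / 6) := by simp
    rw [this, ← Finset.prod_mul_distrib]
    exact Finset.prod_le_prod' fun i _ => aux_gauss_one _
  have h2 := key s
  rw [Measure.pi, toMeasure_apply _ _ hs]
  refine le_trans ?_ h2
  simp only [hn, Measure.toOuterMeasure_apply, Measure.smul_apply, smul_eq_mul]
  rw [Measure.restrict_apply hs, Set.inter_eq_self_of_subset_left hsub]

lemma aux_law {N : ℕ} {Ω : Type} [MeasurableSpace Ω] (P : Measure Ω) [IsProbabilityMeasure P]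
    (X : Fin N → Ω → ℝ) (S : Matrix (Fin N) (Fin N) ℝ) (hS : S.PosSemidef)
    (hX : IsCenteredGaussianVec P X S) :
    (∀ i, AEMeasurable (X i) P) ∧
    P.map (fun ω => WithLp.toLp 2 (fun i => X i ω)) =
      multivariateGaussian (0 : EuclideanSpace ℝ (Fin N)) S := by
  have hae : ∀ u : Fin N → ℝ, AEMeasurable (fun ω => ∑ i, u i * X i ω) P := by
    intro u
    by_contra h
    have h1 := hX u
    rw [Measure.map_of_not_aemeasurable h] at h1
    exact (IsProbabilityMeasure.ne_zero _) h1.symm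
  have hm : ∀ i, AEMeasurable (X i) P := by
    intro i
    have := hae (Pi.single i 1)
    simpa [Pi.single_apply] using this
  refine ⟨hm, ?_⟩
  have hm2 : AEMeasurable (fun ω => (WithLp.toLp 2 (fun i => X i ω) : EuclideanSpace ℝ (Fin N))) P := by
    have h1 : AEMeasurable (fun ω => (fun i => X i ω)) P := aemeasurable_pi_lambda _ hm
    exact (WithLp.measurable_toLp 2 (Fin N → ℝ)).comp_aemeasurable h1
  have : IsProbabilityMeasure (P.map (fun ω => (WithLp.toLp 2 (fun i => X i ω) : EuclideanSpace ℝ (Fin N)))) :=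
    Measure.isProbabilityMeasure_map hm2
  apply Measure.ext_of_charFun
  ext t
  rw [charFun_multivariateGaussian hS]
  rw [charFun_apply, integral_map hm2 (by fun_prop)]
  have h1 := hX t.ofLp
  have h2 : charFun (P.map (fun ω => ∑ i, t.ofLp i * X i ω)) 1 = 
     ∫ ω, Complex.exp (((∑ i, t.ofLp i * X i ω : ℝ) : ℂ) * Complex.I) ∂P := by
    rw [charFun_apply_real, integral_map (hae _) (by fun_prop)]
    simp
  rw [h1, charFun_gaussianReal] at h2
  have h3 : (0:ℝ) ≤ t.ofLp ⬝ᵥ S *ᵥ t.ofLp := by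
    simpa using hS.dotProduct_mulVec_nonneg t.ofLp
  simp only [PiLp.inner_apply]
  simp only [RCLike.inner_apply, conj_trivial]
  rw [← h2]
  simp [Real.coe_toNNReal _ h3]

lemma aux_det {N : ℕ} (S : Matrix (Fin N) (Fin N) ℝ) (hS : S.PosSemidef) :
    S.det ≤ S.trace ^ N := by
  have hd := hS.1.det_eq_prod_eigenvalues
  have ht := hS.1.trace_eq_sum_eigenvalues
  simp only [RCLike.ofReal_real_eq_id, id_eq] at hd ht
  rw [hd]
  have : S.trace ^ N = ∏ _i : Fin N, S.trace := by simp
  rw [this]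
  refine Finset.prod_le_prod (fun i _ => hS.eigenvalues_nonneg i) fun i _ => ?_
  rw [ht]
  exact Finset.single_le_sum (fun i _ => hS.eigenvalues_nonneg i) (Finset.mem_univ i)

open scoped MatrixOrder in
lemma aux_gauss_lower {N : ℕ} (hN : 1 ≤ N) {Ω : Type} [MeasurableSpace Ω] (P : Measure Ω)
    [IsProbabilityMeasure P]
    (X : Fin N → Ω → ℝ) (S : Matrix (Fin N) (Fin N) ℝ) (hS : S.IsHermitian)
    (l T : ℝ) (hl : 0 < l) (hq : ∀ u : Fin N → ℝ, l * ∑ i, u i ^ 2 ≤ u ⬝ᵥ S *ᵥ u)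
    (hT : S.trace ≤ T)
    (hX : IsCenteredGaussianVec P X S) :
    ENNReal.ofReal ((1 / 6) ^ N * ((√(T ^ N))⁻¹ * √(l / N) ^ N)) ≤
      P {ω | ∀ m : Fin N, 0 < X m ω} := by
  have hSp : S.PosSemidef := by
    refine Matrix.PosSemidef.of_dotProduct_mulVec_nonneg hS fun u => ?_
    have := hq u
    simp only [star_trivial]
    refine le_trans ?_ this
    positivity
  have hSd : S.PosDef := by
    refine Matrix.PosDef.of_dotProduct_mulVec_pos hS fun u hu => ?_
    simp only [star_trivial]
    refine lt_of_lt_of_le ?_ (hq u)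
    apply mul_pos hl
    obtain ⟨i, hi⟩ := Function.ne_iff.mp hu
    exact lt_of_lt_of_le (by have : u i ≠ 0 := hi
                             positivity)
      (Finset.single_le_sum (f := fun i => u i ^ 2) (fun i _ => sq_nonneg _) (Finset.mem_univ i))
  obtain ⟨hm, hlaw⟩ := aux_law P X S hSp hX
  set A := CFC.sqrt S with hA
  have hAA : A * A = S := CFC.sqrt_mul_sqrt_self S hSp.nonneg
  have hAh : Aᵀ = A := by
    have := (CFC.sqrt_nonneg S).posSemidef.1
    simpa [Matrix.IsHermitian, conjTranspose_eq_transpose_of_trivial] using this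
  have hdetA : A.det * A.det = S.det := by rw [← det_mul, hAA]
  have hSpos : 0 < S.det := hSd.det_pos
  have hA0 : A.det ≠ 0 := by
    intro h; rw [h] at hdetA; simp at hdetA; linarith
  have hdet : |A.det| = √S.det := by
    rw [← hdetA, Real.sqrt_mul_self_eq_abs]
  have hdetle : |A.det| ≤ √(T ^ N) := by
    rw [hdet]
    apply Real.sqrt_le_sqrt
    exact (aux_det S hSp).trans (pow_le_pow_left₀ hSp.trace_nonneg hT N)
  set d := √(l / N) with hd
  have hNpos : (0:ℝ) < N := by exact_mod_cast hN
  have hdpos : 0 < d := Real.sqrt_pos.mpr (by positivity)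
  have hd2 : N * d ^ 2 = l := by
    rw [hd, Real.sq_sqrt (by positivity)]; field_simp
  set B : Set (Fin N → ℝ) := Set.univ.pi fun _ => Set.Ioo 0 d with hB
  have hBm : MeasurableSet B := MeasurableSet.univ_pi fun _ => measurableSet_Ioo
  have hcont : Measurable (toLin' A) := (LinearMap.continuous_of_finiteDimensional _).measurable
  set s : Set (Fin N → ℝ) := toLin' A ⁻¹' B with hs
  have hsm : MeasurableSet s := hcont hBm
  have hsub : s ⊆ Set.univ.pi fun _ => Set.Icc (-1:ℝ) 1 := by
    intro y hy i _
    have hyi : ∀ i, (A *ᵥ y) i ∈ Set.Ioo 0 d := fun i => hy i (Set.mem_univ i)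
    have h1 := hq y
    have h2 : y ⬝ᵥ S *ᵥ y = ∑ i, (A *ᵥ y) i ^ 2 := by
      rw [← hAA, ← mulVec_mulVec, dotProduct_mulVec, ← mulVec_transpose, hAh]
      simp [dotProduct, sq]
    have h3 : ∑ i, (A *ᵥ y) i ^ 2 ≤ N * d ^ 2 := by
      have : ∑ i, (A *ᵥ y) i ^ 2 ≤ ∑ _i : Fin N, d ^ 2 :=
        Finset.sum_le_sum fun i _ => pow_le_pow_left₀ (hyi i).1.le (hyi i).2.le 2
      simpa using this
    have h4 : y i ^ 2 ≤ ∑ i, y i ^ 2 :=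
      Finset.single_le_sum (f := fun i => y i ^ 2) (fun i _ => sq_nonneg _) (Finset.mem_univ i)
    have h5 : y i ^ 2 ≤ 1 := by
      rw [h2] at h1
      have : l * (y i ^ 2) ≤ l * 1 := by nlinarith
      exact le_of_mul_le_mul_left this hl
    exact abs_le.mp ((sq_le_one_iff_abs_le_one _).mp h5)
  have hvol : volume s = ENNReal.ofReal (|A.det|⁻¹ * d ^ N) := by
    have h1 := congrArg (fun m => m B) (Real.map_matrix_volume_pi_eq_smul_volume_pi hA0)
    simp only [Measure.smul_apply, smul_eq_mul] at h1
    rw [Measure.map_apply hcont hBm] at h1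
    rw [hs, h1, hB, volume_pi_pi, ENNReal.ofReal_mul (by positivity), abs_inv]
    simp [ENNReal.ofReal_pow hdpos.le]
  have hE : MeasurableSet {x : EuclideanSpace ℝ (Fin N) | ∀ m, 0 < x m} := by
    have : {x : EuclideanSpace ℝ (Fin N) | ∀ m, 0 < x m} = ⋂ m, {x | 0 < x m} := by
      ext; simp
    rw [this]
    exact MeasurableSet.iInter fun m => measurableSet_lt measurable_const (by fun_prop)
  have hm2 : AEMeasurable (fun ω => (WithLp.toLp 2 (fun i => X i ω) : EuclideanSpace ℝ (Fin N))) P := by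
    have h1 : AEMeasurable (fun ω => (fun i => X i ω)) P := aemeasurable_pi_lambda _ hm
    exact (WithLp.measurable_toLp 2 (Fin N → ℝ)).comp_aemeasurable h1
  have hP : P {ω | ∀ m : Fin N, 0 < X m ω} =
      multivariateGaussian (0 : EuclideanSpace ℝ (Fin N)) S {x | ∀ m, 0 < x m} := by
    rw [← hlaw, Measure.map_apply_of_aemeasurable hm2 hE]
    rfl
  rw [hP, multivariateGaussian, Measure.map_apply (by fun_prop) hE, ← map_pi_eq_stdGaussian,
    Measure.map_apply (by fun_prop) (hE.preimage (by fun_prop))]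
  refine le_trans ?_ (measure_mono (s := s) ?_)
  · refine le_trans ?_ (aux_gauss_pi N s hsm hsub)
    rw [hvol, ENNReal.ofReal_mul (by positivity), ENNReal.ofReal_pow (by norm_num)]
    gcongr
  · intro y hy m
    have := (hy m (Set.mem_univ m)).1
    simpa [Matrix.ofLp_toEuclideanCLM] using this

lemma aux_log_sin_nonpos (x : ℝ) : 0 ≤ -Real.log (Real.sin x) := by
  have := Real.log_nonpos (abs_nonneg (Real.sin x)) (Real.abs_sin_le_one x)
  rw [Real.log_abs] at this
  linarith

lemma aux_log_sin_int : ∃ K : ℝ, 0 ≤ K ∧ ∀ θ : ℝ,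
    ∫⁻ t, ENNReal.ofReal (-Real.log (Real.sin (t - θ))) ∂normLeb1 ≤ ENNReal.ofReal K := by
  have hII : ∀ a b : ℝ, IntervalIntegrable (fun t => -Real.log (Real.sin t)) volume a b :=
    fun a b => (intervalIntegrable_log_sin (a := a) (b := b)).neg
  refine ⟨(2 * Real.pi)⁻¹ * ∫ t in (-Real.pi)..Real.pi, -Real.log (Real.sin t), ?_, ?_⟩
  · refine mul_nonneg (by positivity) (intervalIntegral.integral_nonneg ?_ ?_)
    · linarith [Real.pi_pos]
    · intro u _; exact aux_log_sin_nonpos u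
  · intro θ
    have hpi : -Real.pi ≤ Real.pi := by linarith [Real.pi_pos]
    rw [normLeb1, lintegral_smul_measure,
      ENNReal.ofReal_mul (p := (2 * Real.pi)⁻¹) (by positivity),
      ENNReal.ofReal_inv_of_pos (by positivity), smul_eq_mul]
    gcongr
    rw [Measure.restrict_congr_set Ioc_ae_eq_Icc.symm]
    have h1 : IntervalIntegrable (fun t => -Real.log (Real.sin (t - θ))) volume (-Real.pi) Real.pi := by
      have := (hII (-Real.pi - θ) (Real.pi - θ)).comp_sub_right θ
      simpa using this
    rw [intervalIntegrable_iff_integrableOn_Ioc_of_le hpi] at h1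
    rw [← ofReal_integral_eq_lintegral_ofReal h1 (ae_of_all _ fun t => aux_log_sin_nonpos _)]
    apply ENNReal.ofReal_le_ofReal
    rw [← intervalIntegral.integral_of_le hpi,
      intervalIntegral.integral_comp_sub_right (fun t => -Real.log (Real.sin t)) θ]
    have hper : Function.Periodic (fun t => -Real.log (Real.sin t)) (2 * Real.pi) := by
      intro t; simp
    have := hper.intervalIntegral_add_eq (-Real.pi - θ) (-Real.pi)
    rw [show -Real.pi - θ + 2 * Real.pi = Real.pi - θ by ring,
      show -Real.pi + 2 * Real.pi = Real.pi by ring] at this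
    exact this.le

lemma aux_sin_le (w : ℂ) (t : ℝ) :
    max 1 ‖w‖ * |Real.sin (t - w.arg)| ≤ ‖Complex.exp (Complex.I * t) - w‖ := by
  have hw : w = ‖w‖ * Complex.exp (w.arg * Complex.I) := (Complex.norm_mul_exp_arg_mul_I w).symm
  have key : ∀ z : ℝ, ‖Complex.exp (Complex.I * t) - w‖ =
      ‖(Complex.exp (Complex.I * t) - w) * Complex.exp (z * Complex.I)‖ := by
    intro z
    rw [norm_mul, Complex.norm_exp_ofReal_mul_I, mul_one]
  rw [max_mul_of_nonneg _ _ (abs_nonneg _)]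
  refine max_le ?_ ?_
  · rw [key (-w.arg), one_mul]
    refine le_trans (le_of_eq ?_) (Complex.abs_im_le_norm _)
    congr 1
    have hw1 : w * Complex.exp (((-w.arg : ℝ) : ℂ) * Complex.I) = ‖w‖ := by
      nth_rw 1 [hw]
      rw [mul_assoc, ← Complex.exp_add]
      simp
    rw [sub_mul, ← Complex.exp_add, hw1]
    have e1 : Complex.I * t + ((-w.arg : ℝ) : ℂ) * Complex.I = ((t - w.arg : ℝ) : ℂ) * Complex.I := by
      push_cast; ring
    rw [e1, Complex.sub_im, Complex.exp_ofReal_mul_I_im]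
    simp
  · rw [key (-t)]
    refine le_trans (le_of_eq ?_) (Complex.abs_im_le_norm _)
    have hw1 : w * Complex.exp (((-t : ℝ) : ℂ) * Complex.I) =
        ‖w‖ * Complex.exp ((w.arg : ℂ) * Complex.I + ((-t : ℝ) : ℂ) * Complex.I) := by
      nth_rw 1 [hw]
      rw [mul_assoc, ← Complex.exp_add]
    rw [sub_mul, ← Complex.exp_add, hw1]
    have e1 : (w.arg : ℂ) * Complex.I + ((-t : ℝ) : ℂ) * Complex.I = ((w.arg - t : ℝ) : ℂ) * Complex.I := by
      push_cast; ring
    have e2 : Complex.I * t + ((-t : ℝ) : ℂ) * Complex.I = 0 := by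
      push_cast; ring
    rw [e1, e2, Complex.sub_im, Complex.im_ofReal_mul, Complex.exp_ofReal_mul_I_im]
    rw [show w.arg - t = -(t - w.arg) by ring, Real.sin_neg]
    simp [abs_mul]

/-- the product of the sines attached to a multiset of complex numbers -/
def sinProd (r : Multiset ℂ) (t : ℝ) : ℝ := (r.map fun w => |Real.sin (t - w.arg)|).prod

def logSum (r : Multiset ℂ) (t : ℝ) : ENNReal :=
  (r.map fun w => ENNReal.ofReal (-Real.log (Real.sin (t - w.arg)))).sum

lemma aux_poly (p : Polynomial ℂ) (t : ℝ) :
    p.mahlerMeasure * sinProd p.roots t ≤ ‖p.eval (Complex.exp (Complex.I * t))‖ := by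
  rw [Polynomial.mahlerMeasure_eq_leadingCoeff_mul_prod_roots]
  have h := (IsAlgClosed.splits p).eval_eq_prod_roots (Complex.exp (Complex.I * t))
  rw [h, norm_mul, mul_assoc, sinProd, ← Multiset.prod_map_mul]
  gcongr
  have : ‖(p.roots.map fun a => Complex.exp (Complex.I * t) - a).prod‖ =
      (p.roots.map fun a => ‖Complex.exp (Complex.I * t) - a‖).prod := by
    have := (Multiset.prod_hom (p.roots.map fun a => Complex.exp (Complex.I * t) - a)
      (normHom : ℂ →*₀ ℝ)).symm
    rw [Multiset.map_map] at this
    exact this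
  rw [this]
  refine Multiset.prod_map_le_prod_map₀ _ _ (fun i _ => by positivity) fun i _ => aux_sin_le i t

lemma measurable_sinProd (r : Multiset ℂ) : Measurable (sinProd r) := by
  induction r using Multiset.induction_on with
  | empty => unfold sinProd; simp only [Multiset.map_zero, Multiset.prod_zero]; exact measurable_const
  | cons a s ih =>
    have : sinProd (a ::ₘ s) = fun t => |Real.sin (t - a.arg)| * sinProd s t := by
      ext t; simp [sinProd]
    rw [this]; fun_prop

lemma measurable_logSum (r : Multiset ℂ) : Measurable (logSum r) := by
  induction r using Multiset.induction_on with
  | empty => unfold logSum; simp only [Multiset.map_zero, Multiset.sum_zero]; exact measurable_const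
  | cons a s ih =>
    have : logSum (a ::ₘ s) = fun t => ENNReal.ofReal (-Real.log (Real.sin (t - a.arg))) + logSum s t := by
      ext t; simp [logSum]
    rw [this]; fun_prop

lemma lintegral_logSum (K : ℝ) (hK : ∀ θ : ℝ,
    ∫⁻ t, ENNReal.ofReal (-Real.log (Real.sin (t - θ))) ∂normLeb1 ≤ ENNReal.ofReal K)
    (r : Multiset ℂ) : ∫⁻ t, logSum r t ∂normLeb1 ≤ r.card * ENNReal.ofReal K := by
  induction r using Multiset.induction_on with
  | empty => simp [logSum]
  | cons a s ih =>
    have : logSum (a ::ₘ s) = fun t => ENNReal.ofReal (-Real.log (Real.sin (t - a.arg))) + logSum s t := by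
      ext t; simp [logSum]
    rw [this, lintegral_add_right _ (measurable_logSum s)]
    simp only [Multiset.card_cons, Nat.cast_add, Nat.cast_one, add_mul, one_mul]
    rw [add_comm]
    exact add_le_add ih (hK _)

lemma sinProd_eq (r : Multiset ℂ) (t : ℝ) (h : ∀ w ∈ r, Real.sin (t - w.arg) ≠ 0) :
    ∃ G : ℝ, 0 ≤ G ∧ logSum r t = ENNReal.ofReal G ∧ sinProd r t = Real.exp (-G) := by
  induction r using Multiset.induction_on with
  | empty => exact ⟨0, le_rfl, by simp [logSum], by simp [sinProd]⟩
  | cons a s ih =>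
    obtain ⟨G, h0, h1, h2⟩ := ih fun w hw => h w (Multiset.mem_cons_of_mem hw)
    have ha := h a (Multiset.mem_cons_self a s)
    refine ⟨-Real.log (Real.sin (t - a.arg)) + G, add_nonneg (aux_log_sin_nonpos _) h0, ?_, ?_⟩
    · rw [ENNReal.ofReal_add (aux_log_sin_nonpos _) h0, ← h1]; simp [logSum]
    · rw [neg_add, Real.exp_add, ← h2, neg_neg, ← Real.log_abs, Real.exp_log (abs_pos.mpr ha)]
      simp [sinProd]

lemma normLeb1_null (θ : ℝ) : ∀ᵐ t ∂normLeb1, Real.sin (t - θ) ≠ 0 := by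
  have h1 : normLeb1 ≪ volume := by
    rw [normLeb1]
    exact (Measure.smul_absolutelyContinuous).trans Measure.absolutelyContinuous_restrict
  apply h1.ae_le
  have h2 : {t : ℝ | Real.sin (t - θ) = 0} ⊆ Set.range (fun n : ℤ => (n : ℝ) * Real.pi + θ) := by
    intro t ht
    obtain ⟨n, hn⟩ := Real.sin_eq_zero_iff.mp ht
    exact ⟨n, by simp only; linarith⟩
  have := ((Set.countable_range _).mono h2).measure_zero volume
  rw [mem_ae_iff]
  simpa [Set.compl_def] using this

lemma aux_bad (K : ℝ) (hK : ∀ θ : ℝ,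
    ∫⁻ t, ENNReal.ofReal (-Real.log (Real.sin (t - θ))) ∂normLeb1 ≤ ENNReal.ofReal K)
    (r : Multiset ℂ) (n : ℕ) (hn : 1 ≤ n) (hr : r.card ≤ n) (M : ℝ) (hM : 0 < M) :
    normLeb1 {t | sinProd r t < Real.exp (-(n * M))} ≤ ENNReal.ofReal (K / M) := by
  have hnpos : (0:ℝ) < n := by exact_mod_cast hn
  have h1 : normLeb1 {t | sinProd r t < Real.exp (-(n * M))} ≤
      normLeb1 {t | ENNReal.ofReal (n * M) ≤ logSum r t} := by
    apply measure_mono_ae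
    have h : ∀ᵐ t ∂normLeb1, ∀ w ∈ r.toFinset, Real.sin (t - w.arg) ≠ 0 :=
      (ae_ball_iff (Finset.countable_toSet _)).mpr fun w _ => normLeb1_null _
    filter_upwards [h] with t ht hlt
    obtain ⟨G, h0, h1, h2⟩ := sinProd_eq r t fun w hw => ht w (Multiset.mem_toFinset.mpr hw)
    have hlt' : sinProd r t < Real.exp (-(n * M)) := hlt
    rw [h2, Real.exp_lt_exp] at hlt'
    change ENNReal.ofReal (n * M) ≤ logSum r t
    rw [h1]
    exact ENNReal.ofReal_le_ofReal (by linarith)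
  refine h1.trans ?_
  have h2 := mul_meas_ge_le_lintegral (μ := normLeb1) (measurable_logSum r) (ENNReal.ofReal (n * M))
  have h3 := h2.trans (lintegral_logSum K hK r)
  have h4 : (r.card : ENNReal) * ENNReal.ofReal K ≤ ENNReal.ofReal (n * M) * ENNReal.ofReal (K / M) := by
    rw [← ENNReal.ofReal_mul (by positivity)]
    have : (n * M) * (K / M) = n * K := by field_simp
    rw [this, ENNReal.ofReal_mul (by positivity), ENNReal.ofReal_natCast]
    gcongr
  have h5 := h3.trans h4
  rwa [ENNReal.mul_le_mul_iff_right (by rw [Ne, ENNReal.ofReal_eq_zero, not_le]; positivity) ENNReal.ofReal_ne_top] at h5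

/-- the polynomial with coefficients `u` -/
def trigPoly {N : ℕ} (u : Fin N → ℝ) : Polynomial ℂ :=
  ∑ j : Fin N, Polynomial.monomial j.1 (u j : ℂ)

lemma trigPoly_coeff {N : ℕ} (u : Fin N → ℝ) (k : Fin N) : (trigPoly u).coeff k.1 = u k := by
  simp only [trigPoly, Polynomial.finsetSum_coeff, Polynomial.coeff_monomial]
  simp [Fin.val_inj]

lemma trigPoly_natDegree {N : ℕ} (u : Fin N → ℝ) : (trigPoly u).natDegree ≤ N := by
  refine Polynomial.natDegree_sum_le_of_forall_le _ _ fun j _ => ?_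
  exact (Polynomial.natDegree_monomial_le _).trans j.2.le

lemma trigPoly_normSq {N : ℕ} (u : Fin N → ℝ) (t : ℝ) :
    ‖(trigPoly u).eval (Complex.exp (Complex.I * t))‖ ^ 2 =
      ∑ j : Fin N, ∑ k : Fin N, u j * (u k *
        (Complex.exp (Complex.I * (((j.1 : ℤ) - (k.1 : ℤ) : ℤ) : ℂ) * t)).re) := by
  have h1 : (trigPoly u).eval (Complex.exp (Complex.I * t)) =
      ∑ j : Fin N, (u j : ℂ) * Complex.exp (((j.1 * t : ℝ) : ℂ) * Complex.I) := by
    simp only [trigPoly, Polynomial.eval_finsetSum, Polynomial.eval_monomial]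
    refine Finset.sum_congr rfl fun j _ => ?_
    rw [← Complex.exp_nat_mul]
    congr 2
    push_cast; ring
  have h2 : ∀ j k : Fin N, (Complex.exp (Complex.I * (((j.1 : ℤ) - (k.1 : ℤ) : ℤ) : ℂ) * t)).re =
      Real.cos (j.1 * t) * Real.cos (k.1 * t) + Real.sin (j.1 * t) * Real.sin (k.1 * t) := by
    intro j k
    rw [← Real.cos_sub, ← Complex.exp_ofReal_mul_I_re]
    congr 2
    push_cast; ring
  rw [h1, Complex.sq_norm, Complex.normSq_apply]
  simp only [Complex.re_sum, Complex.im_sum, Complex.re_ofReal_mul, Complex.im_ofReal_mul,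
    Complex.exp_ofReal_mul_I_re, Complex.exp_ofReal_mul_I_im, h2]
  rw [Finset.sum_mul_sum, Finset.sum_mul_sum, ← Finset.sum_add_distrib]
  refine Finset.sum_congr rfl fun j _ => ?_
  rw [← Finset.sum_add_distrib]
  refine Finset.sum_congr rfl fun k _ => ?_
  ring

lemma exp_integrable (μ : Measure ℝ) [IsFiniteMeasure μ] (m : ℤ) :
    Integrable (fun t : ℝ => Complex.exp (Complex.I * (m : ℂ) * (t : ℂ))) μ := by
  refine Integrable.of_bound (by fun_prop) 1 (ae_of_all _ fun t => ?_)
  rw [show Complex.I * (m : ℂ) * (t : ℂ) = ((m * t : ℝ) : ℂ) * Complex.I by push_cast; ring,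
    Complex.norm_exp_ofReal_mul_I]

lemma quad_eq_s1 (μ : Measure ℝ) [IsFiniteMeasure μ] {N : ℕ} (u : Fin N → ℝ) :
    Integrable (fun t : ℝ => ‖(trigPoly u).eval (Complex.exp (Complex.I * t))‖ ^ 2) μ ∧
    u ⬝ᵥ (SigmaN μ N).mulVec u =
      ∫ t, ‖(trigPoly u).eval (Complex.exp (Complex.I * t))‖ ^ 2 ∂μ := by
  have hre : ∀ j k : Fin N, Integrable (fun t : ℝ =>
      u j * (u k * (Complex.exp (Complex.I * (((j.1 : ℤ) - (k.1 : ℤ) : ℤ) : ℂ) * t)).re)) μ :=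
    fun j k => ((exp_integrable μ _).re.const_mul _).const_mul _
  simp only [trigPoly_normSq]
  refine ⟨integrable_finsetSum _ fun j _ => integrable_finsetSum _ fun k _ => hre j k, ?_⟩
  rw [integral_finsetSum _ fun j _ => integrable_finsetSum _ fun k _ => hre j k]
  simp only [dotProduct, mulVec]
  refine Finset.sum_congr rfl fun j _ => ?_
  rw [integral_finsetSum _ fun k _ => hre j k, Finset.mul_sum]
  refine Finset.sum_congr rfl fun k _ => ?_
  rw [integral_const_mul, integral_const_mul, SigmaN, muHat1]
  have h := integral_re (exp_integrable μ ((j.1 : ℤ) - (k.1 : ℤ)))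
  simp only [RCLike.re_eq_complex_re] at h
  rw [← h]
  ring

lemma sum_sq_le {N : ℕ} (u : Fin N → ℝ) :
    ∑ k, u k ^ 2 ≤ N * (4 ^ N * (trigPoly u).mahlerMeasure ^ 2) := by
  have : ∀ k : Fin N, u k ^ 2 ≤ 4 ^ N * (trigPoly u).mahlerMeasure ^ 2 := by
    intro k
    have h1 := Polynomial.norm_coeff_le_choose_mul_mahlerMeasure k.1 (trigPoly u)
    rw [trigPoly_coeff, Complex.norm_real, Real.norm_eq_abs] at h1
    have h2 : (((trigPoly u).natDegree.choose k.1 : ℕ) : ℝ) ≤ 2 ^ N := by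
      have h3 := Nat.choose_le_two_pow (trigPoly u).natDegree k.1
      have h4 : 2 ^ (trigPoly u).natDegree ≤ 2 ^ N :=
        Nat.pow_le_pow_right (by norm_num) (trigPoly_natDegree u)
      exact_mod_cast h3.trans h4
    have h5 : |u k| ≤ 2 ^ N * (trigPoly u).mahlerMeasure :=
      h1.trans (mul_le_mul_of_nonneg_right h2 (Polynomial.mahlerMeasure_nonneg _))
    calc u k ^ 2 = |u k| ^ 2 := (sq_abs _).symm
      _ ≤ (2 ^ N * (trigPoly u).mahlerMeasure) ^ 2 := pow_le_pow_left₀ (abs_nonneg _) h5 2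
      _ = _ := by
        rw [mul_pow, ← pow_mul, mul_comm N 2, pow_mul]; norm_num
  calc ∑ k, u k ^ 2 ≤ ∑ _k : Fin N, 4 ^ N * (trigPoly u).mahlerMeasure ^ 2 :=
        Finset.sum_le_sum fun k _ => this k
    _ = _ := by simp

lemma quad_lower (μ μs : Measure ℝ) (b : ℝ → ℝ)
    (hfin : IsFiniteMeasure μ)
    (hint : Integrable b normLeb1)
    (hbnn : ∀ᵐ t ∂normLeb1, 0 ≤ b t)
    (hdecomp : μ = normLeb1.withDensity (fun t => ENNReal.ofReal (b t)) + μs)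
    (hbne : ¬ (∀ᵐ t ∂normLeb1, b t = 0)) :
    ∃ c C : ℝ, 0 < c ∧ 0 ≤ C ∧ ∀ N : ℕ, 1 ≤ N → ∀ u : Fin N → ℝ,
      c * Real.exp (-(C * N)) * ∑ i, u i ^ 2 ≤ u ⬝ᵥ (SigmaN μ N).mulVec u := by
  obtain ⟨K, hK0, hK⟩ := aux_log_sin_int
  set f : ℝ → ENNReal := fun t => ENNReal.ofReal (b t) with hf
  set ν := normLeb1.withDensity f with hν
  have hfm : AEMeasurable f normLeb1 := hint.aestronglyMeasurable.aemeasurable.ennreal_ofReal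
  have hV : ∫⁻ t, f t ∂normLeb1 = ν Set.univ := by rw [hν, withDensity_apply _ MeasurableSet.univ]; simp
  have hνμ : ν ≤ μ := by rw [hdecomp]; exact Measure.le_add_right le_rfl
  have hνfin : IsFiniteMeasure ν := isFiniteMeasure_of_le μ hνμ
  have hV0 : ν Set.univ ≠ 0 := by
    rw [← hV]
    intro h
    rw [lintegral_eq_zero_iff' hfm] at h
    apply hbne
    filter_upwards [h, hbnn] with t h1 h2
    have : b t ≤ 0 := by simpa [hf] using h1
    linarith
  have hVt : ν Set.univ ≠ ⊤ := measure_ne_top _ _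
  have hV2 : ν Set.univ / 2 ≠ 0 := by simpa using hV0
  obtain ⟨δ, hδ, hδ'⟩ := exists_pos_setLIntegral_lt_of_measure_lt (by rw [hV]; exact hVt) hV2
  obtain ⟨M, hM, hMδ⟩ : ∃ M : ℝ, 0 < M ∧ ENNReal.ofReal (K / M) < δ := by
    obtain ⟨e, he0, he⟩ := ENNReal.lt_iff_exists_nnreal_btwn.mp hδ
    have he0' : (0:ℝ) < e := by exact_mod_cast he0
    refine ⟨(K + 1) / e, by positivity, lt_of_le_of_lt ?_ he⟩
    rw [← ENNReal.ofReal_coe_nnreal]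
    apply ENNReal.ofReal_le_ofReal
    rw [div_div_eq_mul_div, div_le_iff₀ (by positivity)]
    nlinarith
  set v := (ν Set.univ / 2).toReal with hv
  have hvt : ν Set.univ / 2 ≠ ⊤ := ENNReal.div_ne_top hVt (by norm_num)
  have hvpos : 0 < v := ENNReal.toReal_pos hV2 hvt
  refine ⟨v, 2 * M + 3, hvpos, by positivity, fun N hN u => ?_⟩
  obtain ⟨hI, hq⟩ := quad_eq_s1 μ u
  set p := trigPoly u with hp
  set g : Set ℝ := {t | sinProd p.roots t < Real.exp (-(N * M))} with hg
  have hgm : MeasurableSet g := measurableSet_lt (measurable_sinProd _) measurable_const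
  have hcard : p.roots.card ≤ N := (Polynomial.card_roots' p).trans (trigPoly_natDegree u)
  have hbad : ν g < ν Set.univ / 2 := by
    rw [hν, withDensity_apply _ hgm]
    exact hδ' g ((aux_bad K hK p.roots N hN hcard M hM).trans_lt hMδ)
  have hgood : ν Set.univ / 2 ≤ ν gᶜ := by
    by_contra h
    push Not at h
    have h1 := measure_add_measure_compl (μ := ν) hgm
    have h2 := ENNReal.add_lt_add hbad h
    rw [h1, ENNReal.add_halves] at h2
    exact lt_irrefl _ h2
  set Q := p.mahlerMeasure ^ 2 * Real.exp (-(2 * N * M)) with hQ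
  have hQ0 : 0 ≤ Q := by positivity
  have hpt : ∀ t ∈ gᶜ, Q ≤ ‖p.eval (Complex.exp (Complex.I * t))‖ ^ 2 := by
    intro t ht
    have ht' : Real.exp (-(N * M)) ≤ sinProd p.roots t := not_lt.mp ht
    have h1 := aux_poly p t
    have h2 : p.mahlerMeasure * Real.exp (-(N * M)) ≤ ‖p.eval (Complex.exp (Complex.I * t))‖ :=
      (mul_le_mul_of_nonneg_left ht' (Polynomial.mahlerMeasure_nonneg _)).trans h1
    have h3 := pow_le_pow_left₀ (mul_nonneg (Polynomial.mahlerMeasure_nonneg _) (Real.exp_pos _).le) h2 2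
    refine le_trans (le_of_eq ?_) h3
    rw [hQ, mul_pow, ← Real.exp_nat_mul]
    congr 2
    push_cast; ring
  have hlow : v * Q ≤ u ⬝ᵥ (SigmaN μ N).mulVec u := by
    have hnn : 0 ≤ u ⬝ᵥ (SigmaN μ N).mulVec u := by
      rw [hq]; exact integral_nonneg fun t => by positivity
    rw [← ENNReal.ofReal_le_ofReal_iff hnn, hq,
      ofReal_integral_eq_lintegral_ofReal hI (ae_of_all _ fun t => by positivity)]
    calc ENNReal.ofReal (v * Q) = ENNReal.ofReal Q * (ν Set.univ / 2) := by
          rw [mul_comm, ENNReal.ofReal_mul hQ0, hv, ENNReal.ofReal_toReal hvt]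
      _ ≤ ENNReal.ofReal Q * ν gᶜ := by gcongr
      _ = ∫⁻ t in gᶜ, ENNReal.ofReal Q ∂ν := by rw [setLIntegral_const]
      _ ≤ ∫⁻ t in gᶜ, ENNReal.ofReal (‖p.eval (Complex.exp (Complex.I * t))‖ ^ 2) ∂ν :=
          setLIntegral_mono' hgm.compl fun t ht => ENNReal.ofReal_le_ofReal (hpt t ht)
      _ ≤ ∫⁻ t, ENNReal.ofReal (‖p.eval (Complex.exp (Complex.I * t))‖ ^ 2) ∂ν :=
          setLIntegral_le_lintegral _ _
      _ ≤ _ := lintegral_mono' hνμ le_rfl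
  refine le_trans ?_ hlow
  rw [mul_assoc]
  apply mul_le_mul_of_nonneg_left _ hvpos.le
  have hs := sum_sq_le u
  rw [← hp] at hs
  have hN1 : (N:ℝ) ≤ Real.exp N := by linarith [Real.add_one_le_exp (N:ℝ)]
  have hN4 : (4:ℝ) ^ N ≤ Real.exp (2 * N) := by
    rw [mul_comm, Real.exp_nat_mul]
    apply pow_le_pow_left₀ (by norm_num)
    have h := Real.add_one_le_exp (1:ℝ)
    have : Real.exp 2 = Real.exp 1 * Real.exp 1 := by rw [← Real.exp_add]; norm_num
    rw [this]; nlinarith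
  calc Real.exp (-((2 * M + 3) * N)) * ∑ i, u i ^ 2
      ≤ Real.exp (-((2 * M + 3) * N)) * (Real.exp N * (Real.exp (2 * N) * p.mahlerMeasure ^ 2)) := by
        gcongr
        refine hs.trans ?_
        gcongr
    _ = Q := by
        rw [hQ, ← mul_assoc, ← mul_assoc, ← Real.exp_add, ← Real.exp_add, mul_comm]
        congr 2
        ring

lemma muHat1_re (μ : Measure ℝ) [IsFiniteMeasure μ] (m : ℤ) :
    (muHat1 μ m).re = ∫ t, Real.cos (m * t) ∂μ := by
  have h := integral_re (exp_integrable μ m)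
  simp only [RCLike.re_eq_complex_re] at h
  rw [muHat1, ← h]
  congr 1
  ext t
  rw [show Complex.I * (m : ℂ) * (t : ℂ) = ((m * t : ℝ) : ℂ) * Complex.I by push_cast; ring,
    Complex.exp_ofReal_mul_I_re]

lemma SigmaN_herm (μ : Measure ℝ) [IsFiniteMeasure μ] (N : ℕ) : (SigmaN μ N).IsHermitian := by
  ext j k
  simp only [conjTranspose_apply, star_trivial, SigmaN, muHat1_re]
  congr 1
  ext t
  rw [← Real.cos_neg]
  congr 1
  push_cast; ring

lemma SigmaN_trace (μ : Measure ℝ) [IsFiniteMeasure μ] (N : ℕ) :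
    (SigmaN μ N).trace = N * μ.real Set.univ := by
  simp [Matrix.trace, SigmaN, muHat1_re]

/-- If the density `b` of the absolutely continuous part of the
spectral measure is not a.e. zero, then there is a finite constant `γ` (depending
on `μ`) with `H_X(N) ≥ e^{-γ N²}` for all `N ≥ 1`. -/
theorem persistence_N_squared_lower_bound
    (μ μs : Measure ℝ) (b : ℝ → ℝ)
    (hfin : IsFiniteMeasure μ)
    (hsupp : μ {t : ℝ | ¬ |t| ≤ Real.pi} = 0)
    (hsym : μ.map (fun t => -t) = μ)
    (hint : Integrable b normLeb1)
    (hbnn : ∀ᵐ t ∂normLeb1, 0 ≤ b t)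
    (hsing : μs.MutuallySingular normLeb1)
    (hdecomp : μ = normLeb1.withDensity (fun t => ENNReal.ofReal (b t)) + μs)
    (hbne : ¬ (∀ᵐ t ∂normLeb1, b t = 0)) :
    ∃ γ : ℝ,
      ∀ N : ℕ, 1 ≤ N →
        ∀ (Ω : Type) [MeasurableSpace Ω] (P : Measure Ω),
          IsProbabilityMeasure P →
          ∀ X : Fin N → Ω → ℝ,
            IsCenteredGaussianVec P X (SigmaN μ N) →
            ENNReal.ofReal (Real.exp (-γ * (N : ℝ) ^ 2)) ≤
              P {ω | ∀ m : Fin N, 0 < X m ω} := by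
  obtain ⟨c, C, hc, hC, hq⟩ := quad_lower μ μs b hfin hint hbnn hdecomp hbne
  set m := μ.real Set.univ + 1 with hm
  have hmpos : 0 < m := by have : 0 ≤ μ.real Set.univ := measureReal_nonneg
                           linarith
  set D := |Real.log (c / m)| with hD
  refine ⟨2 + (C + D + 2) / 2, fun N hN Ω _ P hP X hX => ?_⟩
  have hNpos : (0:ℝ) < N := by exact_mod_cast hN
  have hN1 : (1:ℝ) ≤ N := by exact_mod_cast hN
  have h := aux_gauss_lower hN P X (SigmaN μ N) (SigmaN_herm μ N)
    (c * Real.exp (-(C * N))) (N * m) (by positivity) (hq N hN)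
    (by rw [SigmaN_trace]; gcongr; linarith) hX
  refine le_trans (ENNReal.ofReal_le_ofReal ?_) h
  have e1 : √((N * m) ^ N) = √(N * m) ^ N := by
    rw [Real.sqrt_eq_iff_mul_self_eq (by positivity) (by positivity), ← mul_pow,
      Real.mul_self_sqrt (by positivity)]
  rw [e1, ← inv_pow, ← mul_pow, ← mul_pow, sq, ← mul_assoc, mul_comm, Real.exp_nat_mul]
  apply pow_le_pow_left₀ (Real.exp_pos _).le
  rw [← Real.sqrt_inv, ← Real.sqrt_mul (by positivity)]
  have hNe : (N:ℝ) ≤ Real.exp N := by linarith [Real.add_one_le_exp (N:ℝ)]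
  have hcm : Real.exp (-(D * N)) ≤ c / m := by
    have h1 : Real.log (c / m) ≥ -(D * N) := by
      have := neg_abs_le (Real.log (c / m))
      have h2 : 0 ≤ D := abs_nonneg _
      nlinarith
    calc Real.exp (-(D * N)) ≤ Real.exp (Real.log (c / m)) := Real.exp_le_exp.mpr h1
      _ = c / m := Real.exp_log (by positivity)
  have h6 : Real.exp (-(2 * N)) ≤ 1 / 6 := by
    have h1 : (6:ℝ) ≤ Real.exp 2 := by
      have h := Real.exp_one_gt_d9
      have : Real.exp 2 = Real.exp 1 * Real.exp 1 := by rw [← Real.exp_add]; norm_num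
      rw [this]; nlinarith
    have h2 : Real.exp 2 ≤ Real.exp (2 * N) := Real.exp_le_exp.mpr (by linarith)
    rw [Real.exp_neg, one_div]
    exact inv_anti₀ (by norm_num) (h1.trans h2)
  have hs : Real.exp (-((C + D + 2) / 2 * N)) ≤
      √((N * m)⁻¹ * (c * Real.exp (-(C * N)) / N)) := by
    apply Real.le_sqrt_of_sq_le
    rw [← Real.exp_nat_mul]
    have e2 : (N * m)⁻¹ * (c * Real.exp (-(C * N)) / N) =
        (c / m) * Real.exp (-(C * N)) * ((N:ℝ)⁻¹ * (N:ℝ)⁻¹) := by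
      field_simp
    have e3 : Real.exp (((2:ℕ):ℝ) * -((C + D + 2) / 2 * N)) =
        Real.exp (-(D * N)) * Real.exp (-(C * N)) * (Real.exp (-N) * Real.exp (-N)) := by
      rw [← Real.exp_add, ← Real.exp_add, ← Real.exp_add]
      congr 1
      push_cast; ring
    have e4 : Real.exp (-N) ≤ (N:ℝ)⁻¹ := by
      rw [Real.exp_neg]; exact inv_anti₀ hNpos hNe
    rw [e2, e3]
    gcongr
  calc Real.exp (-(2 + (C + D + 2) / 2) * N)
      = Real.exp (-(2 * N)) * Real.exp (-((C + D + 2) / 2 * N)) := by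
        rw [← Real.exp_add]; congr 1; ring
    _ ≤ _ := by gcongr
end
end

section
/- Let μ be a finite Borel measure on T^d = [-π,π]^d, symmetric about the origin, and let A ⊆ Z^d be finite and nonempty. Let σ_A denote the smallest eigenvalue of Σ_A = (μ̂(j-k))_{j,k∈A} and suppose σ_A > 0. Then the centered Gaussian vector (X_m)_{m∈A} with covariance matrix Σ_A satisfies H_X(A) = P(X_m > 0 for all m ∈ A) ≥ (σ_A / (4 μ̂(0)))^{|A|/2}. -/
open MeasureTheory ProbabilityTheory Matrix

noncomputable section

lemma gauss_pi_density {ι : Type*} [Fintype ι] :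
    Measure.pi (fun _ : ι => gaussianReal 0 1) =
      (volume : Measure (ι → ℝ)).withDensity
        (fun x => ENNReal.ofReal (∏ i, gaussianPDFReal 0 1 (x i))) := by
  symm
  refine (Measure.pi_eq ?_).symm
  intro s hs
  rw [withDensity_apply _ (MeasurableSet.univ_pi hs)]
  rw [volume_pi, Measure.restrict_pi_pi]
  rw [← ofReal_integral_eq_lintegral_ofReal]
  · rw [integral_fintype_prod_eq_prod (𝕜 := ℝ) (fun _ : ι => gaussianPDFReal 0 1)]
    rw [ENNReal.ofReal_prod_of_nonneg]
    · refine Finset.prod_congr rfl fun i _ => ?_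
      rw [gaussianReal_apply_eq_integral _ one_ne_zero]
    · intro i _
      exact integral_nonneg fun x => gaussianPDFReal_nonneg _ _ _
  · exact Integrable.fintype_prod (f := fun _ : ι => gaussianPDFReal 0 1)
      fun i => (integrable_gaussianPDFReal 0 1).restrict
  · exact Filter.Eventually.of_forall fun x => Finset.prod_nonneg fun i _ =>
      gaussianPDFReal_nonneg _ _ _

lemma gauss_half : gaussianReal 0 1 (Set.Ioi 0) = 2⁻¹ := by
  have h1 : gaussianReal 0 1 (Set.Iio 0) = gaussianReal 0 1 (Set.Ioi 0) := by
    conv_lhs => rw [show (0 : ℝ) = -0 by simp, ← gaussianReal_map_neg]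
    rw [Measure.map_apply (by fun_prop) measurableSet_Iio]
    congr 1
    ext x; simp
  have : NullSingletonClass (gaussianReal 0 1) := nullSingletonClass_gaussianReal one_ne_zero
  have h2 := prob_add_prob_compl (μ := gaussianReal 0 1) (s := Set.Ioi 0) measurableSet_Ioi
  rw [Set.compl_Ioi, ← Iio_ae_eq_Iic.measure_eq (μ := gaussianReal 0 1), h1, ← two_mul] at h2
  exact ENNReal.eq_inv_of_mul_eq_one_left (by rwa [mul_comm])

lemma prod_pdf {ι : Type*} [Fintype ι] (x : ι → ℝ) :
    ∏ i, gaussianPDFReal 0 1 (x i) =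
      (∏ _i : ι, (√(2 * Real.pi * (1 : NNReal)))⁻¹) * Real.exp (-(x ⬝ᵥ x) / 2) := by
  simp only [gaussianPDFReal, Finset.prod_mul_distrib, ← Real.exp_sum]
  congr 2
  simp [dotProduct, Finset.sum_neg_distrib, ← Finset.sum_div, sq]

lemma gauss_expand {ι : Type*} [Fintype ι] [DecidableEq ι] (S : Matrix ι ι ℝ) (hS : S.det ≠ 0)
    (hexp : ∀ y : ι → ℝ, y ⬝ᵥ y ≤ (S *ᵥ y) ⬝ᵥ (S *ᵥ y)) :
    ENNReal.ofReal |S.det⁻¹| * (2⁻¹) ^ Fintype.card ι ≤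
      Measure.pi (fun _ : ι => gaussianReal 0 1) {y | ∀ i, 0 < (S *ᵥ y) i} := by
  set O : Set (ι → ℝ) := {x | ∀ i, 0 < x i} with hO
  have hOpi : O = Set.univ.pi (fun _ : ι => Set.Ioi (0 : ℝ)) := by
    ext x; simp [hO]
  have hOm : MeasurableSet O := by
    rw [hOpi]; exact MeasurableSet.univ_pi fun _ => measurableSet_Ioi
  have hSm : Measurable (fun y : ι → ℝ => S *ᵥ y) :=
    (Continuous.matrix_mulVec continuous_const continuous_id).measurable
  set g : (ι → ℝ) → ENNReal := fun x => ENNReal.ofReal (∏ i, gaussianPDFReal 0 1 (x i)) with hg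
  have hgm : Measurable g := by
    refine ENNReal.measurable_ofReal.comp ?_
    exact Finset.measurable_prod _ fun i _ =>
      (measurable_gaussianPDFReal 0 1).comp (measurable_pi_apply i)
  have hmap := Real.map_matrix_volume_pi_eq_smul_volume_pi hS
  have hO' : Measure.pi (fun _ : ι => gaussianReal 0 1) O = (2⁻¹) ^ Fintype.card ι := by
    rw [hOpi, Measure.pi_pi]
    simp [gauss_half]
  have hpre : {y : ι → ℝ | ∀ i, 0 < (S *ᵥ y) i} = (fun y => S *ᵥ y) ⁻¹' O := rfl
  rw [← hO', hpre, gauss_pi_density, withDensity_apply _ hOm, withDensity_apply _ (hSm hOm),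
    ← smul_eq_mul, ← lintegral_smul_measure, ← Measure.restrict_smul, ← hmap]
  rw [show (⇑(toLin' S)) = fun y => S *ᵥ y from rfl]
  rw [setLIntegral_map hOm hgm hSm]
  refine lintegral_mono fun y => ?_
  simp only [hg]
  refine ENNReal.ofReal_le_ofReal ?_
  rw [prod_pdf, prod_pdf]
  refine mul_le_mul_of_nonneg_left ?_ (by positivity)
  refine Real.exp_le_exp.2 ?_
  linarith [hexp y]

lemma law_eq {ι : Type*} [Fintype ι] [DecidableEq ι] {Ω : Type*} [MeasurableSpace Ω]
    (P : Measure Ω) [IsProbabilityMeasure P]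
    (X : ι → Ω → ℝ) (S L : Matrix ι ι ℝ) (hL : L * Lᵀ = S) (hX : IsCenteredGaussianVec P X S) :
    AEMeasurable (fun ω i => X i ω) P ∧ P.map (fun ω i => X i ω) =
      (Measure.pi (fun _ : ι => gaussianReal 0 1)).map (fun y => L *ᵥ y) := by
  have hm : AEMeasurable (fun ω i => X i ω) P := by
    refine aemeasurable_pi_lambda _ fun i => ?_
    have h := hX (Pi.single i 1)
    by_contra hn
    rw [show (fun ω => ∑ j, (Pi.single i 1 : ι → ℝ) j * X j ω) = X i by
      ext ω; simp [Pi.single_apply]] at h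
    rw [Measure.map_of_not_aemeasurable hn] at h
    exact (IsProbabilityMeasure.ne_zero _) h.symm
  refine ⟨hm, ?_⟩
  have hLm : Measurable (fun y : ι → ℝ => L *ᵥ y) :=
    (Continuous.matrix_mulVec continuous_const continuous_id).measurable
  have : IsProbabilityMeasure (P.map (fun ω i => X i ω)) := Measure.isProbabilityMeasure_map hm
  have : IsProbabilityMeasure ((Measure.pi (fun _ : ι => gaussianReal 0 1)).map (fun y => L *ᵥ y)) :=
    Measure.isProbabilityMeasure_map hLm.aemeasurable
  refine Measure.ext_of_charFunDual ?_
  ext ℓ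
  set u : ι → ℝ := fun i => ℓ (Pi.single i 1) with hu
  have hℓ : ∀ x : ι → ℝ, ℓ x = u ⬝ᵥ x := by
    intro x
    conv_lhs => rw [← Finset.univ_sum_single x]
    rw [map_sum, dotProduct]
    refine Finset.sum_congr rfl fun i _ => ?_
    rw [show Pi.single i (x i) = x i • (Pi.single i 1 : ι → ℝ) by simp [← Pi.single_smul], map_smul, smul_eq_mul, mul_comm]
  have hvar : u ⬝ᵥ S *ᵥ u = (u ᵥ* L) ⬝ᵥ (u ᵥ* L) := by
    rw [← hL, ← mulVec_mulVec, dotProduct_mulVec, mulVec_transpose]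
  have hvar0 : 0 ≤ u ⬝ᵥ S *ᵥ u := by
    rw [hvar]; exact Finset.sum_nonneg fun i _ => mul_self_nonneg _
  rw [charFunDual_eq_charFun_map_one, AEMeasurable.map_map_of_aemeasurable (by fun_prop) hm]
  rw [show (⇑ℓ ∘ fun ω i => X i ω) = fun ω => ∑ i, u i * X i ω by
    ext ω; simp [hℓ, dotProduct]]
  rw [hX u, charFun_gaussianReal, charFunDual_apply, integral_map hLm.aemeasurable (by fun_prop)]
  have : ∀ y : ι → ℝ, Complex.exp (ℓ (L *ᵥ y) * Complex.I) =
      ∏ i, Complex.exp (((u ᵥ* L) i : ℂ) * (y i : ℂ) * Complex.I) := by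
    intro y
    rw [hℓ, dotProduct_mulVec, dotProduct, ← Complex.exp_sum, ← Finset.sum_mul]
    push_cast; rfl
  simp_rw [this]
  rw [integral_fintype_prod_eq_prod (𝕜 := ℂ) (μ := fun _ : ι => gaussianReal 0 1)
    (fun i (y : ℝ) => Complex.exp (((u ᵥ* L) i : ℂ) * (y : ℂ) * Complex.I))]
  simp_rw [← charFun_apply_real, charFun_gaussianReal]
  rw [← Complex.exp_sum, Real.coe_toNNReal _ hvar0, hvar]
  congr 1
  simp [dotProduct, Finset.sum_neg_distrib, ← Finset.sum_div, sq]

lemma prod_le_pow {ι : Type*} [Fintype ι] [Nonempty ι] (l : ι → ℝ) (hl : ∀ i, 0 ≤ l i) (m : ℝ)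
    (hm : ∑ i, l i = Fintype.card ι * m) : ∏ i, l i ≤ m ^ Fintype.card ι := by
  have hc : (0 : ℝ) < Fintype.card ι := by exact_mod_cast Fintype.card_pos
  have h := Real.geom_mean_le_arith_mean Finset.univ (fun _ => 1) l (by simp) (by simpa using hc)
    (fun i _ => hl i)
  simp only [Real.rpow_one, one_mul, Finset.sum_const, Finset.card_univ, nsmul_eq_mul, mul_one] at h
  rw [hm, mul_div_cancel_left₀ _ hc.ne'] at h
  have hp : 0 ≤ ∏ i, l i := Finset.prod_nonneg fun i _ => hl i
  have h2 := pow_le_pow_left₀ (Real.rpow_nonneg hp _) h (Fintype.card ι)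
  rwa [Real.rpow_inv_natCast_pow hp Fintype.card_ne_zero] at h2

lemma sigma_herm {d : ℕ} (μ : Measure (Fin d → ℝ)) (A : Finset (Fin d → ℤ)) :
    (SigmaA μ A).IsHermitian := by
  ext j k
  simp only [conjTranspose_apply, SigmaA, star_trivial]
  rw [← neg_sub j.1 k.1, ← Complex.conj_re]
  congr 1
  rw [muHat, ← integral_conj, muHat]
  congr 1
  ext t
  rw [← Complex.exp_conj]
  congr 1
  simp only [map_mul, map_sum, Complex.conj_I, Complex.conj_ofReal, map_intCast, neg_mul, ← mul_neg,
    ← Finset.sum_neg_distrib]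
  congr 1
  refine Finset.sum_congr rfl fun x _ => ?_
  simp only [Pi.sub_apply, Pi.neg_apply]
  push_cast
  ring

lemma sqrt_factor {ι : Type*} [Fintype ι] [DecidableEq ι] (S : Matrix ι ι ℝ) (hS : S.IsHermitian)
    (σ : ℝ) (hσ : 0 < σ) (hmin : ∀ i, σ ≤ hS.eigenvalues i) :
    ∃ L : Matrix ι ι ℝ, L * Lᵀ = S ∧ ∀ y : ι → ℝ, σ * (y ⬝ᵥ y) ≤ (L *ᵥ y) ⬝ᵥ (L *ᵥ y) := by
  have hpos : ∀ i, 0 ≤ hS.eigenvalues i := fun i => hσ.le.trans (hmin i)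
  set U : Matrix ι ι ℝ := hS.eigenvectorUnitary.1 with hU
  have hUU : Uᵀ * U = 1 := by
    have := Unitary.coe_star_mul_self hS.eigenvectorUnitary
    simpa [star_eq_conjTranspose] using this
  set D : Matrix ι ι ℝ := diagonal fun i => √(hS.eigenvalues i) with hD
  have hDD : D * D = diagonal hS.eigenvalues := by
    rw [hD, diagonal_mul_diagonal]
    congr 1; ext i; exact Real.mul_self_sqrt (hpos i)
  have hDt : Dᵀ = D := by simp [hD]
  refine ⟨U * D, ?_, fun y => ?_⟩
  · rw [transpose_mul, hDt, Matrix.mul_assoc, ← Matrix.mul_assoc D, hDD]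
    conv_rhs => rw [hS.spectral_theorem]
    simp [Unitary.conjStarAlgAut_apply, star_eq_conjTranspose, hU, Matrix.mul_assoc, Function.comp_def]
  · rw [dotProduct_mulVec, ← mulVec_transpose, mulVec_mulVec, transpose_mul, hDt, Matrix.mul_assoc,
      ← Matrix.mul_assoc Uᵀ, hUU, Matrix.one_mul, hDD]
    simp only [dotProduct, mulVec_diagonal, Finset.mul_sum]
    refine Finset.sum_le_sum fun i _ => ?_
    nlinarith [mul_le_mul_of_nonneg_right (hmin i) (mul_self_nonneg (y i))]

/-- If `σ_A > 0` is the smallest eigenvalue of `Σ_A`, then the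
centered Gaussian vector with covariance `Σ_A` satisfies
`H_X(A) ≥ (σ_A / (4 μ̂(0)))^{|A|/2}`. -/
theorem persistence_lower_bound_smallest_eigenvalue
    (d : ℕ) (hd : 1 ≤ d) (μ : Measure (Fin d → ℝ))
    (hfin : IsFiniteMeasure μ)
    (hsupp : μ {t : Fin d → ℝ | ¬ ∀ j, |t j| ≤ Real.pi} = 0)
    (hsym : μ.map (fun t => -t) = μ)
    (A : Finset (Fin d → ℤ)) (hA : A.Nonempty)
    (σ : ℝ) (hσ : 0 < σ)
    (heig : Module.End.HasEigenvalue (Matrix.mulVecLin (SigmaA μ A)) σ)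
    (hmin : ∀ x : ℝ, Module.End.HasEigenvalue (Matrix.mulVecLin (SigmaA μ A)) x →
      σ ≤ x)
    (Ω : Type) [MeasurableSpace Ω] (P : Measure Ω) [IsProbabilityMeasure P]
    (X : A → Ω → ℝ) (hX : IsCenteredGaussianVec P X (SigmaA μ A)) :
    ENNReal.ofReal ((σ / (4 * (muHat μ 0).re)) ^ ((A.card : ℝ) / 2)) ≤
      P {ω | ∀ m : A, 0 < X m ω} := by
  have hS := sigma_herm μ A
  set S := SigmaA μ A with hSdef
  have hne : Nonempty A := hA.to_subtype
  have hcard : Fintype.card A = A.card := Fintype.card_coe A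
  have hev : ∀ i, σ ≤ hS.eigenvalues i := by
    intro i
    refine hmin _ ?_
    refine Module.End.hasEigenvalue_of_hasEigenvector (x := ⇑(hS.eigenvectorBasis i)) ?_
    refine ⟨Module.End.mem_eigenspace_iff.2 ?_, ?_⟩
    · exact hS.mulVec_eigenvectorBasis i
    · intro h0
      have h1 := hS.eigenvectorBasis.orthonormal.ne_zero i
      apply h1
      ext j
      exact congrFun h0 j
  obtain ⟨L, hL, hLexp⟩ := sqrt_factor S hS σ hσ hev
  obtain ⟨hm, hlaw⟩ := law_eq P X S L hL hX
  set m := (muHat μ 0).re with hmdef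
  have htr : ∑ i, hS.eigenvalues i = Fintype.card A * m := by
    have h := hS.trace_eq_sum_eigenvalues
    simp only [RCLike.ofReal_real_eq_id, id] at h
    rw [← h, Matrix.trace]
    simp [hSdef, SigmaA, hmdef]
  have hdet : S.det = ∏ i, hS.eigenvalues i := by
    simpa using hS.det_eq_prod_eigenvalues
  have hdetpos : 0 < S.det := by
    rw [hdet]; exact Finset.prod_pos fun i _ => hσ.trans_le (hev i)
  have hdetle : S.det ≤ m ^ Fintype.card A := by
    rw [hdet]; exact prod_le_pow _ (fun i => hσ.le.trans (hev i)) m htr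
  have hmpos : 0 < m := by
    have hc : (0 : ℝ) < Fintype.card A := by exact_mod_cast Fintype.card_pos
    have : 0 < ∑ i, hS.eigenvalues i :=
      Finset.sum_pos (fun i _ => hσ.trans_le (hev i)) Finset.univ_nonempty
    rw [htr] at this
    exact pos_of_mul_pos_right this hc.le
  have hsq : 0 < √σ := Real.sqrt_pos.2 hσ
  set T : Matrix A A ℝ := (√σ)⁻¹ • L with hT
  have hTT : T.det ^ 2 = S.det / σ ^ Fintype.card A := by
    have h1 : L.det ^ 2 = S.det := by rw [← hL, det_mul, det_transpose, sq]
    rw [hT, det_smul, mul_pow, h1, ← pow_mul, mul_comm (Fintype.card A) 2, pow_mul, inv_pow,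
      Real.sq_sqrt hσ.le, inv_pow]
    field_simp
  have hTT0 : 0 < T.det ^ 2 := by rw [hTT]; positivity
  have hTne : T.det ≠ 0 := by
    intro h; rw [h] at hTT0; simp at hTT0
  have hTexp : ∀ y : A → ℝ, y ⬝ᵥ y ≤ (T *ᵥ y) ⬝ᵥ (T *ᵥ y) := by
    intro y
    rw [hT, smul_mulVec, smul_dotProduct, dotProduct_smul, smul_smul, ← mul_inv,
      Real.mul_self_sqrt hσ.le, smul_eq_mul, inv_mul_eq_div, le_div_iff₀ hσ, mul_comm]
    exact hLexp y
  have hmain := gauss_expand T hTne hTexp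
  have hO : MeasurableSet {x : A → ℝ | ∀ i, 0 < x i} := by
    have : {x : A → ℝ | ∀ i, 0 < x i} = Set.univ.pi (fun _ : A => Set.Ioi (0 : ℝ)) := by
      ext x; simp
    rw [this]; exact MeasurableSet.univ_pi fun _ => measurableSet_Ioi
  have hLm : Measurable (fun y : A → ℝ => L *ᵥ y) :=
    (Continuous.matrix_mulVec continuous_const continuous_id).measurable
  have hP : P {ω | ∀ m : A, 0 < X m ω} =
      Measure.pi (fun _ : A => gaussianReal 0 1) {y | ∀ i, 0 < (T *ᵥ y) i} := by
    have h1 := Measure.map_apply_of_aemeasurable hm hO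
    rw [hlaw, Measure.map_apply hLm hO] at h1
    refine h1.symm.trans ?_
    congr 1
    ext y
    simp only [Set.mem_preimage, Set.mem_setOf_eq, hT, smul_mulVec, Pi.smul_apply, smul_eq_mul]
    refine forall_congr' fun i => ?_
    exact (mul_pos_iff_of_pos_left (inv_pos.2 hsq)).symm
  rw [hP]
  refine le_trans ?_ hmain
  have h2 : (2⁻¹ : ENNReal) = ENNReal.ofReal (2⁻¹) := by
    rw [ENNReal.ofReal_inv_of_pos two_pos]; simp
  rw [h2, ← ENNReal.ofReal_pow (by norm_num), ← ENNReal.ofReal_mul (abs_nonneg _)]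
  refine ENNReal.ofReal_le_ofReal ?_
  have hq : 0 ≤ σ / (4 * m) := by positivity
  refine (sq_le_sq₀ (by positivity) (by positivity)).1 ?_
  rw [← hcard]
  rw [← Real.rpow_natCast (_ ^ _) 2, ← Real.rpow_mul hq]
  rw [show ((Fintype.card A : ℝ) / 2 * (2 : ℕ)) = (Fintype.card A : ℕ) by push_cast; ring,
    Real.rpow_natCast, mul_pow, sq_abs, inv_pow, hTT, ← pow_mul, mul_comm (Fintype.card A) 2,
    pow_mul, inv_div, div_pow, mul_pow]
  have h4 : ((2 : ℝ)⁻¹ ^ 2) ^ Fintype.card A = ((4 : ℝ) ^ Fintype.card A)⁻¹ := by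
    rw [← inv_pow]; norm_num
  rw [h4, ← div_eq_mul_inv, div_div, mul_comm]
  gcongr
end
end

section
/- Let μ be a finite Borel measure on T = [-π,π], symmetric about the origin, with dμ = b dλ + dμ_s (μ_s ⊥ λ, b ≥ 0 in L¹(T,λ)), and suppose b is not λ-a.e. equal to zero. Then there exists a finite constant γ such that for every N ≥ 1, the smallest eigenvalue of the N×N matrix Σ_N = (μ̂(j-k))_{1≤j,k≤N} is at least e^{-γ N}. -/
open MeasureTheory ProbabilityTheory Matrix

noncomputable section

lemma aux_select (L : ℝ) (hL : 0 < L) (n : ℕ) : ∀ (S : Set ℝ), MeasurableSet S → BddBelow S →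
    ENNReal.ofReal (2 * L * n) ≤ volume S →
    ∃ t : ℕ → ℝ, (∀ i < n, t i ∈ S) ∧ ∀ i j, i < j → j < n → L * ((j : ℝ) - i) ≤ t j - t i := by
  induction n with
  | zero => intro S _ _ _; exact ⟨fun _ => 0, by simp, by simp⟩
  | succ n ih =>
    intro S hS hb hv
    have hne : S.Nonempty := by
      by_contra h
      rw [Set.not_nonempty_iff_eq_empty] at h
      subst h
      simp only [measure_empty, nonpos_iff_eq_zero, ENNReal.ofReal_eq_zero] at hv
      have : 0 < 2 * L * ((n + 1 : ℕ) : ℝ) := by positivity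
      linarith
    obtain ⟨t0, ht0, ht0'⟩ := Real.lt_sInf_add_pos hne hL
    have hsub : S ⊆ (S ∩ Set.Ici (t0 + L)) ∪ Set.Ico (sInf S) (sInf S + 2 * L) := by
      intro x hx
      by_cases h : t0 + L ≤ x
      · exact Or.inl ⟨hx, h⟩
      · right
        exact ⟨csInf_le hb hx, by push Not at h; linarith⟩
    have h1 : ENNReal.ofReal (2 * L * n) ≤ volume (S ∩ Set.Ici (t0 + L)) := by
      have h2 := (hv.trans (measure_mono hsub)).trans (measure_union_le _ _)
      rw [Real.volume_Ico] at h2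
      have e : 2 * L * ((n + 1 : ℕ) : ℝ) = 2 * L * n + 2 * L := by push_cast; ring
      rw [e, ENNReal.ofReal_add (by positivity) (by positivity)] at h2
      rw [show sInf S + 2 * L - sInf S = 2 * L by ring] at h2
      exact (ENNReal.add_le_add_iff_right ENNReal.ofReal_ne_top).1 h2
    obtain ⟨t, ht, htt⟩ := ih _ (hS.inter measurableSet_Ici) (hb.mono Set.inter_subset_left) h1
    refine ⟨fun i => Nat.casesOn i t0 t, ?_, ?_⟩
    · intro i hi
      cases i with
      | zero => exact ht0
      | succ i => exact (ht i (by omega)).1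
    · intro i j hij hj
      cases j with
      | zero => omega
      | succ j =>
        cases i with
        | succ i =>
          have := htt i j (by omega) (by omega)
          simpa using this
        | zero =>
          have h0 : t0 + L ≤ t 0 := (ht 0 (by omega)).2
          have : L * j ≤ t j - t 0 := by
            rcases Nat.eq_zero_or_pos j with h | h
            · subst h; simp
            · simpa using htt 0 j h (by omega)
          change L * (((j + 1 : ℕ) : ℝ) - ((0 : ℕ) : ℝ)) ≤ t j - t0
          push_cast
          linarith

lemma aux_coeff (z : ℕ → ℂ) (hz : ∀ i, ‖z i‖ ≤ 1) (s : Finset ℕ) : ∀ k,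
    ‖(∏ j ∈ s, (Polynomial.X - Polynomial.C (z j))).coeff k‖ ≤ 2 ^ s.card := by
  induction s using Finset.induction_on with
  | empty => intro k; simp [Polynomial.coeff_one]; split_ifs <;> simp
  | insert a s ha ih =>
    intro k
    rw [Finset.prod_insert ha, Finset.card_insert_of_notMem ha, sub_mul, Polynomial.coeff_sub,
      Polynomial.coeff_C_mul]
    have h1 : ‖(Polynomial.X * ∏ j ∈ s, (Polynomial.X - Polynomial.C (z j))).coeff k‖ ≤ 2 ^ s.card := by
      cases k with
      | zero => simp
      | succ k => rw [Polynomial.coeff_X_mul]; exact ih k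
    have h2 : ‖z a * (∏ j ∈ s, (Polynomial.X - Polynomial.C (z j))).coeff k‖ ≤ 2 ^ s.card := by
      rw [norm_mul]
      calc _ ≤ 1 * (2:ℝ) ^ s.card := by gcongr; exact hz a; exact ih k
        _ = _ := one_mul _
    refine (norm_sub_le _ _).trans ?_
    rw [pow_succ]; linarith

lemma aux_prod (i r : ℕ) : ∏ j ∈ (Finset.range (i + 1 + r)).erase i, |(i : ℝ) - j| =
    (i.factorial : ℝ) * r.factorial := by
  induction r with
  | zero =>
    have : (Finset.range (i + 1 + 0)).erase i = Finset.range i := by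
      ext j; simp; omega
    rw [this]
    simp only [Nat.factorial_zero, Nat.cast_one, mul_one]
    rw [← Finset.prod_range_reflect]
    rw [← Finset.prod_range_add_one_eq_factorial, Nat.cast_prod]
    apply Finset.prod_congr rfl
    intro j hj
    have hj := Finset.mem_range.1 hj
    have : ((i - 1 - j : ℕ) : ℝ) = i - 1 - j := by
      rw [Nat.sub_sub, Nat.cast_sub (by omega)]; push_cast; ring
    rw [this]
    rw [abs_of_nonneg] <;> push_cast <;> [ring; skip]
    have : (0:ℝ) ≤ j := by positivity
    linarith
  | succ r ih =>
    have : (Finset.range (i + 1 + (r + 1))).erase i =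
        insert (i + 1 + r) ((Finset.range (i + 1 + r)).erase i) := by
      ext j; simp; omega
    rw [this, Finset.prod_insert (by simp), ih, Nat.factorial_succ]
    have : |(i : ℝ) - ((i + 1 + r : ℕ) : ℝ)| = r + 1 := by
      rw [abs_sub_comm, abs_of_nonneg] <;> push_cast <;> [ring; skip]
      have : (0:ℝ) ≤ r := by positivity
      linarith
    rw [this]; push_cast; ring

lemma aux_chord (t s : ℝ) (h : |t - s| ≤ Real.pi) :
    2 / Real.pi * |t - s| ≤ ‖Complex.exp (Complex.I * t) - Complex.exp (Complex.I * s)‖ := by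
  have e : Complex.exp (Complex.I * t) - Complex.exp (Complex.I * s) =
      Complex.exp (Complex.I * s) * (Complex.exp (Complex.I * (t - s : ℝ)) - 1) := by
    rw [mul_sub, ← Complex.exp_add]; push_cast; ring_nf
  rw [e, norm_mul, mul_comm Complex.I (s:ℂ), Complex.norm_exp_ofReal_mul_I, one_mul,
    Complex.norm_exp_I_mul_ofReal_sub_one]
  have h1 := Real.mul_le_sin (x := |t - s| / 2) (by positivity) (by linarith)
  have h2 : |Real.sin ((t - s) / 2)| = |Real.sin (|t - s| / 2)| := by
    rcases abs_cases (t - s) with ⟨h, _⟩ | ⟨h, _⟩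
    · rw [h]
    · rw [h, neg_div, Real.sin_neg, abs_neg]
  rw [Real.norm_eq_abs, abs_mul, h2]
  have := le_abs_self (Real.sin (|t - s| / 2))
  rw [abs_two]; linarith

lemma aux_remez (m : ℝ) (hm : 0 < m) : ∃ C : ℝ, 1 ≤ C ∧ ∀ (n : ℕ) (v : Fin (n + 1) → ℝ) (E : Set ℝ)
    (a ρ : ℝ), MeasurableSet E → E ⊆ Set.Icc a (a + Real.pi) → ENNReal.ofReal m ≤ volume E → 0 ≤ ρ →
    (∀ t ∈ E, ‖∑ k, (v k : ℂ) * Complex.exp (Complex.I * t) ^ (k : ℕ)‖ ≤ ρ) →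
    ∀ k, |v k| ≤ C ^ (n + 1) * ρ := by
  have hpi := Real.pi_pos
  set K : ℝ := max 1 (4 * Real.pi / m) with hK
  have hK1 : 1 ≤ K := le_max_left _ _
  have hK2 : 4 * Real.pi / m ≤ K := le_max_right _ _
  have he : 1 ≤ Real.exp 1 := by simp
  refine ⟨2 * Real.exp 1 * K, by nlinarith, ?_⟩
  intro n v E a ρ hE hEa hEm hρ hbd k
  set L : ℝ := m / (2 * (n + 1)) with hL
  have hL0 : 0 < L := by positivity
  obtain ⟨t, htE, htt⟩ := aux_select L hL0 (n + 1) E hE (bddBelow_Icc.mono hEa) (by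
    have : 2 * L * ((n + 1 : ℕ) : ℝ) = m := by rw [hL]; push_cast; field_simp
    rw [this]; exact hEm)
  have hsep : ∀ i j, i < n + 1 → j < n + 1 → L * |(i : ℝ) - j| ≤ |t i - t j| := by
    have key : ∀ i j, i < n + 1 → j < n + 1 → i < j → L * |(i : ℝ) - j| ≤ |t i - t j| := by
      intro i j hi hj h
      have h1 := htt i j h hj
      have h2 : (i : ℝ) < j := by exact_mod_cast h
      rw [abs_sub_comm, abs_of_pos (by linarith), abs_sub_comm]
      exact h1.trans (le_abs_self _)
    intro i j hi hj
    rcases lt_trichotomy i j with h | h | h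
    · exact key i j hi hj h
    · subst h; simp
    · have := key j i hj hi h
      rwa [abs_sub_comm, abs_sub_comm (t j)] at this
  set z : ℕ → ℂ := fun i => Complex.exp (Complex.I * t i) with hz
  have hz1 : ∀ i, ‖z i‖ ≤ 1 := by
    intro i
    simp only [hz]
    rw [mul_comm, Complex.norm_exp_ofReal_mul_I]
  have hzsep : ∀ i j, i < n + 1 → j < n + 1 → 2 / Real.pi * L * |(i : ℝ) - j| ≤ ‖z i - z j‖ := by
    intro i j hi hj
    have h1 := hEa (htE i hi)
    have h2 := hEa (htE j hj)
    have h3 := aux_chord (t i) (t j) (by rw [abs_le]; constructor <;> linarith [h1.1, h1.2, h2.1, h2.2])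
    refine le_trans ?_ h3
    rw [mul_assoc]
    gcongr
    exact hsep i j hi hj
  have hinj : Set.InjOn z (Finset.range (n + 1)) := by
    intro i hi j hj hij
    have hi : i < n + 1 := by simpa using hi
    have hj : j < n + 1 := by simpa using hj
    have h1 := hzsep i j hi hj
    rw [hij, sub_self, norm_zero] at h1
    by_contra hne
    have : 0 < |(i : ℝ) - j| := by
      rw [abs_pos, sub_ne_zero]; exact_mod_cast hne
    have : 0 < 2 / Real.pi * L * |(i : ℝ) - j| := by positivity
    linarith
  set p : Polynomial ℂ := ∑ k : Fin (n + 1), Polynomial.C (v k : ℂ) * Polynomial.X ^ (k : ℕ) with hp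
  have hdeg : p.degree < (Finset.range (n + 1)).card := by
    rw [Finset.card_range]
    exact Polynomial.degree_sum_fin_lt _
  have hpc : p.coeff k = v k := by
    rw [hp, Polynomial.finsetSum_coeff]
    simp only [Polynomial.coeff_C_mul_X_pow]
    rw [Finset.sum_eq_single k]
    · simp
    · intro b _ hb
      rw [if_neg]
      intro h
      exact hb (Fin.ext h.symm)
    · simp
  have hpe : ∀ i < n + 1, ‖p.eval (z i)‖ ≤ ρ := by
    intro i hi
    have := hbd (t i) (htE i hi)
    rw [hp, Polynomial.eval_finsetSum]
    simpa using this
  have hint := Lagrange.eq_interpolate hinj hdeg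
  have hco : (v k : ℂ) = ∑ i ∈ Finset.range (n + 1), p.eval (z i) *
      ((∏ j ∈ (Finset.range (n + 1)).erase i, (z i - z j)⁻¹) *
        (∏ j ∈ (Finset.range (n + 1)).erase i, (Polynomial.X - Polynomial.C (z j))).coeff k) := by
    rw [← hpc]
    conv_lhs => rw [hint]
    rw [Lagrange.interpolate_apply, Polynomial.finsetSum_coeff]
    apply Finset.sum_congr rfl
    intro i hi
    rw [Polynomial.coeff_C_mul, Lagrange.basis]
    simp only [Lagrange.basisDivisor]
    rw [Finset.prod_mul_distrib, ← map_prod, Polynomial.coeff_C_mul]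
  have hterm : ∀ i ∈ Finset.range (n + 1), ‖p.eval (z i) *
      ((∏ j ∈ (Finset.range (n + 1)).erase i, (z i - z j)⁻¹) *
        (∏ j ∈ (Finset.range (n + 1)).erase i, (Polynomial.X - Polynomial.C (z j))).coeff k)‖ ≤
      ρ * (K ^ (n + 1) * Real.exp 1 ^ (n + 1)) := by
    intro i hi
    have hi' : i < n + 1 := by simpa using hi
    have hcard : ((Finset.range (n + 1)).erase i).card = n := by
      rw [Finset.card_erase_of_mem hi]; simp
    have hc := aux_coeff z hz1 ((Finset.range (n + 1)).erase i) k
    rw [hcard] at hc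
    have hprod : (2 / Real.pi * L) ^ n * ((n.factorial : ℝ) / 2 ^ n) ≤
        ∏ j ∈ (Finset.range (n + 1)).erase i, ‖z i - z j‖ := by
      have h1 : ∏ j ∈ (Finset.range (n + 1)).erase i, (2 / Real.pi * L * |(i : ℝ) - j|) ≤
        ∏ j ∈ (Finset.range (n + 1)).erase i, ‖z i - z j‖ := by
        apply Finset.prod_le_prod
        · intro j _; positivity
        · intro j hj
          exact hzsep i j hi' (by simpa using (Finset.mem_erase.1 hj).2)
      refine le_trans ?_ h1
      rw [Finset.prod_mul_distrib, Finset.prod_const, hcard]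
      obtain ⟨r, hr⟩ : ∃ r, n = i + r := ⟨n - i, by omega⟩
      rw [show n + 1 = i + 1 + r by omega, aux_prod]
      gcongr
      rw [div_le_iff₀ (by positivity)]
      have h2 := Nat.choose_mul_factorial_mul_factorial (n := n) (k := i) (by omega)
      have h3 : n - i = r := by omega
      rw [h3] at h2
      have h4 : n.choose i ≤ 2 ^ n := Nat.choose_le_two_pow n i
      have : n.factorial ≤ i.factorial * r.factorial * 2 ^ n := by
        rw [← h2]
        calc _ = i.factorial * r.factorial * n.choose i := by ring
          _ ≤ _ := by gcongr
      exact_mod_cast this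
    have hpos : 0 < (2 / Real.pi * L) ^ n * ((n.factorial : ℝ) / 2 ^ n) := by positivity
    have hexp : ((n : ℝ) + 1) ^ n / n.factorial ≤ Real.exp 1 ^ (n + 1) := by
      have := Real.pow_div_factorial_le_exp (x := (n : ℝ) + 1) (by positivity) (n + 1)
      rw [← Real.exp_nat_mul]
      push_cast
      rw [mul_one]
      refine le_trans (le_of_eq ?_) this
      rw [Nat.factorial_succ]; push_cast
      field_simp
      ring
    rw [norm_mul, norm_mul, norm_prod]
    refine mul_le_mul (hpe i hi') ?_ (by positivity) hρ
    calc _ ≤ ((2 / Real.pi * L) ^ n * ((n.factorial : ℝ) / 2 ^ n))⁻¹ * 2 ^ n := by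
          simp only [norm_inv, Finset.prod_inv_distrib]
          exact mul_le_mul (inv_anti₀ hpos hprod) hc (by positivity) (by positivity)
      _ = (4 * Real.pi / m) ^ n * (((n : ℝ) + 1) ^ n / n.factorial) := by
          rw [hL]
          simp only [mul_pow, div_pow, mul_inv, inv_div]
          rw [show (4:ℝ) ^ n = 2 ^ n * 2 ^ n by rw [← mul_pow]; norm_num]
          field_simp
      _ ≤ K ^ n * Real.exp 1 ^ (n + 1) := by gcongr
      _ ≤ K ^ (n + 1) * Real.exp 1 ^ (n + 1) := by
          gcongr
          omega
  have h1 : |v k| = ‖(v k : ℂ)‖ := by simp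
  rw [h1, hco]
  refine (norm_sum_le_of_le _ hterm).trans ?_
  rw [Finset.sum_const, Finset.card_range, nsmul_eq_mul]
  have h2 : ((n + 1 : ℕ) : ℝ) ≤ 2 ^ (n + 1) := by exact_mod_cast (Nat.lt_two_pow_self).le
  calc _ ≤ 2 ^ (n + 1) * (ρ * (K ^ (n + 1) * Real.exp 1 ^ (n + 1))) := by gcongr
    _ = _ := by rw [mul_pow, mul_pow]; ring

lemma aux_set (b : ℝ → ℝ) (hint : Integrable b normLeb1)
    (hbnn : ∀ᵐ t ∂normLeb1, 0 ≤ b t) (hbne : ¬ (∀ᵐ t ∂normLeb1, b t = 0)) :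
    ∃ (E : Set ℝ) (a m c : ℝ), 0 < m ∧ 0 < c ∧ MeasurableSet E ∧ E ⊆ Set.Icc a (a + Real.pi) ∧
      volume E = ENNReal.ofReal m ∧ ∀ B ⊆ E, MeasurableSet B →
        ENNReal.ofReal c * volume B ≤ normLeb1.withDensity (fun t => ENNReal.ofReal (b t)) B := by
  have hpi := Real.pi_pos
  obtain ⟨f, hfm, hbf⟩ := hint.1
  have hfm := hfm.measurable
  have hpos : volume.restrict (Set.Icc (-Real.pi) Real.pi) {t | 0 < f t} ≠ 0 := by
    intro h0
    apply hbne
    have h1 : normLeb1 {t | 0 < f t} = 0 := by simp [normLeb1, h0]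
    have h2 : ∀ᵐ t ∂normLeb1, ¬ 0 < f t := by
      rw [ae_iff]; simpa using h1
    filter_upwards [hbf, hbnn, h2] with t h3 h4 h5
    rw [← h3] at h5
    linarith
  have hpos2 : ∃ a : ℝ, Set.Icc a (a + Real.pi) ⊆ Set.Icc (-Real.pi) Real.pi ∧
      volume ({t | 0 < f t} ∩ Set.Icc a (a + Real.pi)) ≠ 0 := by
    by_contra! hcon
    have h1 := hcon (-Real.pi) (Set.Icc_subset_Icc le_rfl (by linarith))
    have h2 := hcon 0 (Set.Icc_subset_Icc (by linarith) (by linarith))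
    apply hpos
    rw [Measure.restrict_apply (measurableSet_lt measurable_const hfm)]
    refine measure_mono_null ?_ (measure_union_null h1 h2)
    rintro t ⟨ht, ht2⟩
    rcases le_total t 0 with h | h
    · left; exact ⟨ht, ht2.1, by linarith⟩
    · right; exact ⟨ht, h, by linarith [ht2.2]⟩
  obtain ⟨a, ha, hapos⟩ := hpos2
  obtain ⟨k, hk⟩ : ∃ k : ℕ, volume ({t | 1 / ((k : ℝ) + 1) < f t} ∩ Set.Icc a (a + Real.pi)) ≠ 0 := by
    by_contra! hcon
    apply hapos
    refine measure_mono_null ?_ (measure_iUnion_null hcon)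
    rintro t ⟨ht, ht2⟩
    obtain ⟨k, hk⟩ := exists_nat_one_div_lt (show (0:ℝ) < f t from ht)
    exact Set.mem_iUnion.2 ⟨k, hk, ht2⟩
  set E := {t | 1 / ((k : ℝ) + 1) < f t} ∩ Set.Icc a (a + Real.pi) with hE
  have hEm : MeasurableSet E := (measurableSet_lt measurable_const hfm).inter measurableSet_Icc
  have hfin : volume E ≠ ⊤ := by
    apply ne_top_of_le_ne_top _ (measure_mono (Set.inter_subset_right : E ⊆ _))
    simp
  refine ⟨E, a, (volume E).toReal, 1 / (k + 1) * (2 * Real.pi)⁻¹, ENNReal.toReal_pos hk hfin, by positivity,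
    hEm, Set.inter_subset_right, (ENNReal.ofReal_toReal hfin).symm, ?_⟩
  intro B hB hBm
  rw [withDensity_apply _ hBm]
  have h1 : ∫⁻ t in B, ENNReal.ofReal (b t) ∂normLeb1 = ∫⁻ t in B, ENNReal.ofReal (f t) ∂normLeb1 := by
    apply lintegral_congr_ae
    filter_upwards [ae_restrict_of_ae hbf] with t ht
    rw [ht]
  have h2 : ∫⁻ t in B, ENNReal.ofReal (1 / (k + 1)) ∂normLeb1 ≤ ∫⁻ t in B, ENNReal.ofReal (f t) ∂normLeb1 := by
    apply setLIntegral_mono hfm.ennreal_ofReal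
    intro t ht
    exact ENNReal.ofReal_le_ofReal (hB ht).1.le
  rw [h1]
  refine le_trans (le_of_eq ?_) h2
  have h3 : normLeb1 B = ENNReal.ofReal ((2 * Real.pi)⁻¹) * volume B := by
    have : B ∩ Set.Icc (-Real.pi) Real.pi = B :=
      Set.inter_eq_left.2 (fun t ht => ha (hB ht).2)
    rw [normLeb1, Measure.smul_apply, Measure.restrict_apply hBm, this, smul_eq_mul,
      ENNReal.ofReal_inv_of_pos (by positivity)]
  rw [setLIntegral_const, h3, ENNReal.ofReal_mul (by positivity)]
  ring

lemma aux_norm_sq {N : ℕ} (v : Fin N → ℝ) (t : ℝ) :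
    ‖∑ k, (v k : ℂ) * Complex.exp (Complex.I * t) ^ (k : ℕ)‖ ^ 2 =
    ∑ j, ∑ k, v j * (v k * (Complex.exp (Complex.I * (((j.1 : ℤ) - (k.1 : ℤ) : ℤ) : ℂ) * t)).re) := by
  have h : ((‖∑ k, (v k : ℂ) * Complex.exp (Complex.I * t) ^ (k : ℕ)‖ ^ 2 : ℝ) : ℂ) =
    ∑ j, ∑ k, (v j : ℂ) * (v k * (Complex.exp (Complex.I * (((j.1 : ℤ) - (k.1 : ℤ) : ℤ) : ℂ) * t))) := by
    push_cast
    rw [← Complex.mul_conj', map_sum, Finset.sum_mul_sum]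
    refine Finset.sum_congr rfl fun j _ => Finset.sum_congr rfl fun k _ => ?_
    rw [map_mul, map_pow, Complex.conj_ofReal, ← Complex.exp_conj, map_mul, Complex.conj_I,
      Complex.conj_ofReal, ← Complex.exp_nat_mul, ← Complex.exp_nat_mul]
    rw [show Complex.I * ((j.1 : ℂ) - k.1) * t = j.1 * (Complex.I * t) + k.1 * (-Complex.I * t) by ring,
      Complex.exp_add]
    ring
  have h2 := congrArg Complex.re h
  rw [Complex.ofReal_re] at h2
  rw [h2]
  simp only [Complex.re_sum, Complex.re_ofReal_mul]

lemma aux_quad (μ : Measure ℝ) [IsFiniteMeasure μ] {N : ℕ} (v : Fin N → ℝ) :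
    Integrable (fun t : ℝ => ‖∑ k, (v k : ℂ) * Complex.exp (Complex.I * t) ^ (k : ℕ)‖ ^ 2) μ ∧
    v ⬝ᵥ (SigmaN μ N) *ᵥ v =
      ∫ t : ℝ, ‖∑ k, (v k : ℂ) * Complex.exp (Complex.I * t) ^ (k : ℕ)‖ ^ 2 ∂μ := by
  have hI : ∀ m : ℤ, Integrable (fun t : ℝ => Complex.exp (Complex.I * (m : ℂ) * t)) μ := by
    intro m
    apply Integrable.of_bound (C := 1)
    · exact (by fun_prop : Continuous _).aestronglyMeasurable
    · filter_upwards with t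
      rw [show Complex.I * (m : ℂ) * t = ((m * t : ℝ) : ℂ) * Complex.I by push_cast; ring,
        Complex.norm_exp_ofReal_mul_I]
  have hJ : ∀ j k : Fin N, Integrable (fun t : ℝ => v j * (v k *
      (Complex.exp (Complex.I * (((j.1 : ℤ) - (k.1 : ℤ) : ℤ) : ℂ) * t)).re)) μ :=
    fun j k => ((hI _).re.const_mul _).const_mul _
  simp only [aux_norm_sq]
  refine ⟨integrable_finset_sum _ fun j _ => integrable_finset_sum _ fun k _ => hJ j k, ?_⟩
  rw [integral_finset_sum _ fun j _ => integrable_finset_sum _ fun k _ => hJ j k]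
  rw [dotProduct]
  refine Finset.sum_congr rfl fun j _ => ?_
  rw [integral_finset_sum _ fun k _ => hJ j k, mulVec, dotProduct, Finset.mul_sum]
  refine Finset.sum_congr rfl fun k _ => ?_
  rw [integral_const_mul, integral_const_mul]
  have : ∫ t : ℝ, (Complex.exp (Complex.I * (((j.1 : ℤ) - (k.1 : ℤ) : ℤ) : ℂ) * t)).re ∂μ =
      SigmaN μ N j k := by
    have := integral_re (𝕜 := ℂ) (hI ((j.1 : ℤ) - (k.1 : ℤ)))
    exact this
  rw [this]; ring

/-- If `b` is not a.e. zero then there is a constant `γ` such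
that for all `N ≥ 1` the smallest eigenvalue of `Σ_N` is at least `e^{-γN}`. -/
theorem smallest_eigenvalue_exponential_lower_bound
    (μ μs : Measure ℝ) (b : ℝ → ℝ)
    (hfin : IsFiniteMeasure μ)
    (hsupp : μ {t : ℝ | ¬ |t| ≤ Real.pi} = 0)
    (hsym : μ.map (fun t => -t) = μ)
    (hint : Integrable b normLeb1)
    (hbnn : ∀ᵐ t ∂normLeb1, 0 ≤ b t)
    (hsing : μs.MutuallySingular normLeb1)
    (hdecomp : μ = normLeb1.withDensity (fun t => ENNReal.ofReal (b t)) + μs)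
    (hbne : ¬ (∀ᵐ t ∂normLeb1, b t = 0)) :
    ∃ γ : ℝ, ∀ N : ℕ, 1 ≤ N →
      ∀ x : ℝ, Module.End.HasEigenvalue (Matrix.mulVecLin (SigmaN μ N)) x →
        Real.exp (-γ * (N : ℝ)) ≤ x := by
  obtain ⟨E, a, m, c, hm, hc, hE, hEa, hEm, hB⟩ := aux_set b hint hbnn hbne
  obtain ⟨C, hC1, hC⟩ := aux_remez (m / 2) (by positivity)
  have hC0 : 0 < C := by linarith
  set c0 : ℝ := c * m / 8 with hc0
  have hc0p : 0 < c0 := by positivity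
  refine ⟨1 + |Real.log c0| + 2 * Real.log C, ?_⟩
  intro N hN x hx
  obtain ⟨n, rfl⟩ : ∃ n, N = n + 1 := ⟨N - 1, by omega⟩
  obtain ⟨v, hv⟩ := hx.exists_hasEigenvector
  have hv0 := hv.2
  have hvx : (SigmaN μ (n + 1)) *ᵥ v = x • v := by
    have := hv.apply_eq_smul
    simpa using this
  obtain ⟨hqi, hq⟩ := aux_quad μ v
  rw [hvx, dotProduct_smul, smul_eq_mul] at hq
  set g : ℝ → ℝ := fun t => ‖∑ k, (v k : ℂ) * Complex.exp (Complex.I * t) ^ (k : ℕ)‖ with hg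
  have hgc : Continuous g := by rw [hg]; fun_prop
  obtain ⟨k, -, hk⟩ := Finset.exists_max_image Finset.univ (fun k => |v k|) Finset.univ_nonempty
  have hkpos : 0 < |v k| := by
    by_contra h
    apply hv0
    ext i
    have := hk i (Finset.mem_univ _)
    exact abs_eq_zero.1 (le_antisymm (by linarith) (abs_nonneg _))
  set M := |v k| with hM
  set ρ : ℝ := M / (2 * C ^ (n + 1)) with hρ
  have hρ0 : 0 < ρ := by positivity
  have hE1 : MeasurableSet (E ∩ {t | g t ≤ ρ}) :=
    hE.inter (measurableSet_le hgc.measurable measurable_const)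
  have hE2 : MeasurableSet (E ∩ {t | ρ < g t}) :=
    hE.inter (measurableSet_lt measurable_const hgc.measurable)
  have hsmall : volume (E ∩ {t | g t ≤ ρ}) < ENNReal.ofReal (m / 2) := by
    by_contra! hcon
    have h1 := hC n v _ a ρ hE1 (Set.inter_subset_left.trans hEa) hcon hρ0.le
      (fun t ht => ht.2) k
    have h2 : C ^ (n + 1) * ρ = M / 2 := by rw [hρ]; field_simp
    rw [h2] at h1
    change M ≤ M / 2 at h1
    linarith
  have hbig : ENNReal.ofReal (m / 2) ≤ volume (E ∩ {t | ρ < g t}) := by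
    have h1 : volume E ≤ volume (E ∩ {t | g t ≤ ρ}) + volume (E ∩ {t | ρ < g t}) := by
      refine le_trans (measure_mono ?_) (measure_union_le _ _)
      intro t ht
      rcases le_or_gt (g t) ρ with h | h
      · exact Or.inl ⟨ht, h⟩
      · exact Or.inr ⟨ht, h⟩
    rw [hEm, show m = m / 2 + m / 2 by ring, ENNReal.ofReal_add (by positivity) (by positivity)] at h1
    have h2 := h1.trans (add_le_add_left hsmall.le _)
    exact (ENNReal.add_le_add_iff_left ENNReal.ofReal_ne_top).1 h2
  have hmu : c * (m / 2) ≤ μ.real {t | ρ ^ 2 ≤ g t ^ 2} := by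
    have h1 : ENNReal.ofReal (c * (m / 2)) ≤ μ {t | ρ ^ 2 ≤ g t ^ 2} := by
      calc ENNReal.ofReal (c * (m / 2)) = ENNReal.ofReal c * ENNReal.ofReal (m / 2) :=
            ENNReal.ofReal_mul hc.le
        _ ≤ ENNReal.ofReal c * volume (E ∩ {t | ρ < g t}) := by gcongr
        _ ≤ _ := hB _ Set.inter_subset_left hE2
        _ ≤ μ (E ∩ {t | ρ < g t}) := by
            rw [hdecomp, Measure.add_apply]; exact le_self_add
        _ ≤ _ := by
            apply measure_mono
            rintro t ⟨_, ht⟩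
            exact pow_le_pow_left₀ hρ0.le (le_of_lt ht) 2
    exact (ENNReal.ofReal_le_iff_le_toReal (measure_ne_top _ _)).1 h1
  have hmark := mul_meas_ge_le_integral_of_nonneg (μ := μ) (f := fun t => g t ^ 2)
    (Filter.Eventually.of_forall fun t => sq_nonneg _) hqi (ρ ^ 2)
  have hlow : ρ ^ 2 * (c * (m / 2)) ≤ x * (v ⬝ᵥ v) := by
    rw [hq]
    refine le_trans ?_ hmark
    gcongr
  have hvv : v ⬝ᵥ v ≤ (n + 1 : ℕ) * M ^ 2 := by
    rw [dotProduct]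
    calc _ ≤ ∑ i : Fin (n + 1), M ^ 2 := by
          apply Finset.sum_le_sum
          intro i _
          rw [← sq, ← sq_abs]
          exact pow_le_pow_left₀ (abs_nonneg _) (hk i (Finset.mem_univ _)) 2
      _ = _ := by simp
  have hvv0 : 0 ≤ v ⬝ᵥ v := by
    rw [dotProduct]; exact Finset.sum_nonneg fun i _ => mul_self_nonneg _
  have hx0 : 0 < x := by
    by_contra! h
    have : 0 < ρ ^ 2 * (c * (m / 2)) := by positivity
    nlinarith
  have hfin1 : c0 ≤ x * ((n + 1 : ℕ) * (C ^ (n + 1)) ^ 2) := by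
    have h1 : ρ ^ 2 * (c * (m / 2)) ≤ x * ((n + 1 : ℕ) * M ^ 2) := hlow.trans (by gcongr)
    have h2 : ρ ^ 2 * (c * (m / 2)) = M ^ 2 * (c0 / (C ^ (n + 1)) ^ 2) := by
      rw [hρ, hc0]; field_simp; ring
    rw [h2] at h1
    have h3 : c0 / (C ^ (n + 1)) ^ 2 ≤ x * (n + 1 : ℕ) := by
      refine le_of_mul_le_mul_left (h1.trans (le_of_eq ?_)) (show 0 < M ^ 2 by positivity)
      ring
    rw [div_le_iff₀ (by positivity)] at h3
    linarith
  have hNe : ((n + 1 : ℕ) : ℝ) ≤ Real.exp ((n + 1 : ℕ) : ℝ) := by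
    linarith [Real.add_one_le_exp ((n + 1 : ℕ) : ℝ)]
  have hCe : (C ^ (n + 1)) ^ 2 = Real.exp (2 * Real.log C * (n + 1 : ℕ)) := by
    rw [show 2 * Real.log C * ((n + 1 : ℕ) : ℝ) = ((n + 1) * 2 : ℕ) * Real.log C by push_cast; ring,
      Real.exp_nat_mul, Real.exp_log hC0, pow_mul]
  have hce : Real.exp (-|Real.log c0| * (n + 1 : ℕ)) ≤ c0 := by
    conv_rhs => rw [← Real.exp_log hc0p]
    apply Real.exp_le_exp.2
    have h1 := neg_abs_le (Real.log c0)
    have h2 : (1 : ℝ) ≤ (n + 1 : ℕ) := by exact_mod_cast hN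
    nlinarith [abs_nonneg (Real.log c0)]
  have h5 : Real.exp (-|Real.log c0| * (n + 1 : ℕ)) ≤
      x * (Real.exp ((n + 1 : ℕ) : ℝ) * Real.exp (2 * Real.log C * (n + 1 : ℕ))) := by
    refine hce.trans (hfin1.trans ?_)
    rw [hCe]
    gcongr
  rw [← Real.exp_add] at h5
  rw [← div_le_iff₀ (Real.exp_pos _), ← Real.exp_sub] at h5
  refine le_trans (le_of_eq ?_) h5
  congr 1
  ring
end
end
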